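/- arXiv:1502.04396 — 4 statements merged into one kernel-verified Lean document; each statement's English description precedes it below -/
import Mathlib

section
/- Let $N \ge 2$, $s \ge 1$, $\alpha > 1$, and nonnegative weights $\tilde\gamma_1,\ldots,\tilde\gamma_s$ be given, with $\gamma_u = \prod_{j\in u}\tilde\gamma_j$. Suppose $g_1^* = 1$ and, for each $d = 1,\ldots,s-1$, a set $\mathcal{E}_{d+1} \subsetneq \mathcal{Z}_N$ is given and $g_{d+1}^* \in \mathcal{Z}_N \setminus \mathcal{E}_{d+1}$ is chosen so that $e^2(g_1^*,\ldots,g_d^*,g_{d+1}^*) \le e^2(g_1^*,\ldots,g_d^*,g)$ for every $g \in \mathcal{Z}_N \setminus \mathcal{E}_{d+1}$ (with $\mathcal{E}_1 = \emptyset$). Then for every $d$ with $1 \le d \le s$ and every real $\lambda$ with $1/\alpha < \lambda \le 1$, $$e^2(g_1^*,\ldots,g_d^*) \le \left(\frac{1}{\varphi(N)} \sum_{u \subseteq \{1,\ldots,d\}} \gamma_u^{\lambda}\,(2\zeta(\alpha\lambda))^{|u|} \prod_{j\in u}\frac{\varphi(N)}{\varphi(N)-|\mathcal{E}_j|}\right)^{1/\lambda},$$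 where the empty product equals $1$. -/
open Finset
open scoped Classical

/-- The Riemann zeta function `ζ(x) = ∑_{h=1}^∞ h^{-x}` as a real sum. -/
noncomputable def zetaR (x : ℝ) : ℝ := ∑' n : ℕ, ((n : ℝ) + 1) ^ (-x)

/-- `Z_N = {k ∈ {1,…,N-1} : gcd(k,N) = 1}` (for `N ≥ 2` the element `0` is
automatically excluded since `gcd(0,N) = N ≠ 1`). -/
def ZN (N : ℕ) : Finset ℕ := (Finset.range N).filter (fun k => Nat.Coprime k N)

/-- `r_α(γ,h) = γ_{u(h)} ∏_{j ∈ u(h)} |h_j|^{-α}` with product weights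
`γ_u = ∏_{j∈u} γ̃_j`; coordinate `j : Fin d` corresponds to index `j+1`. -/
noncomputable def rpw {d : ℕ} (α : ℝ) (γ : ℕ → ℝ) (h : Fin d → ℤ) : ℝ :=
  ∏ j ∈ Finset.univ.filter (fun j : Fin d => h j ≠ 0), (γ ((j : ℕ) + 1) * |(h j : ℝ)| ^ (-α))

/-- The squared worst-case error
`e²(g) = ∑_{h ∈ ℤ^d \ {0}, h·g ≡ 0 (mod N)} r_α(γ,h)`. -/
noncomputable def err2 {d : ℕ} (N : ℕ) (α : ℝ) (γ : ℕ → ℝ) (g : Fin d → ℕ) : ℝ :=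
  ∑' h : Fin d → ℤ, if h ≠ 0 ∧ ((N : ℤ) ∣ ∑ j, h j * (g j : ℤ)) then rpw α γ h else 0

/-- `θ_{N,d+1,α,γ}(g) = ∑_{h ∈ ℤ^{d+1}, h_{d+1} ≠ 0, h·(g*,g) ≡ 0 (mod N)} r_α(γ,h)`. -/
noncomputable def theta {d : ℕ} (N : ℕ) (α : ℝ) (γ : ℕ → ℝ) (gs : Fin d → ℕ) (g : ℕ) : ℝ :=
  ∑' h : Fin (d + 1) → ℤ,
    if h (Fin.last d) ≠ 0 ∧ ((N : ℤ) ∣ ∑ j, h j * ((Fin.snoc gs g : Fin (d + 1) → ℕ) j : ℤ))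
    then rpw α γ h else 0

/-- `κ_{N,d+1,α,γ}(g) = ∑_{h_{d+1} ∈ ℤ, N ∤ h_{d+1}} ∑_{h ∈ ℤ^d, h·g* ≡ -h_{d+1} g (mod N)}
|h_{d+1}|^{-α} r_α(γ,h)`, encoded with `p = (h_{d+1}, h)`. -/
noncomputable def kappa {d : ℕ} (N : ℕ) (α : ℝ) (γ : ℕ → ℝ) (gs : Fin d → ℕ) (g : ℕ) : ℝ :=
  ∑' p : ℤ × (Fin d → ℤ),
    if ¬ ((N : ℤ) ∣ p.1) ∧ ((N : ℤ) ∣ (∑ j, p.2 j * (gs j : ℤ) + p.1 * (g : ℤ)))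
    then |(p.1 : ℝ)| ^ (-α) * rpw α γ p.2 else 0


open scoped ENNReal

/-- Subadditivity of `x ↦ x ^ p` for infinite sums. -/
lemma aux_rpow_tsum_le {ι : Type*} (f : ι → ℝ≥0∞) {p : ℝ} (hp : 0 < p) (hp1 : p ≤ 1) :
    (∑' i, f i) ^ p ≤ ∑' i, f i ^ p := by
  have hfin : ∀ s : Finset ι, (∑ i ∈ s, f i) ^ p ≤ ∑ i ∈ s, f i ^ p := by
    intro s
    induction s using Finset.induction_on with
    | empty => simp [hp]
    | insert a s ha ih =>
      rw [Finset.sum_insert ha, Finset.sum_insert ha]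
      exact (ENNReal.rpow_add_le_add_rpow _ _ hp.le hp1).trans (by gcongr)
  have h := ((ENNReal.continuous_rpow_const (y := p)).tendsto _).comp
    (ENNReal.summable (f := f)).hasSum
  refine le_of_tendsto h (Filter.Eventually.of_forall fun s => ?_)
  exact (hfin s).trans (ENNReal.sum_le_tsum s)

/-- Weight product. -/
noncomputable def auxP (w : ℕ → ℤ → ℝ≥0∞) {d : ℕ} (h : Fin d → ℤ) : ℝ≥0∞ :=
  ∏ j : Fin d, w j (h j)

/-- Extended version of the squared error. -/
noncomputable def auxS (w : ℕ → ℤ → ℝ≥0∞) (N : ℕ) {d : ℕ} (g : Fin d → ℕ) : ℝ≥0∞ :=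
  ∑' h : Fin d → ℤ, if h ≠ 0 ∧ ((N : ℤ) ∣ ∑ j, h j * (g j : ℤ)) then auxP w h else 0

/-- Extended version of theta. -/
noncomputable def auxT (w : ℕ → ℤ → ℝ≥0∞) (N : ℕ) {d : ℕ} (g : Fin d → ℕ) (x : ℕ) : ℝ≥0∞ :=
  ∑' h : Fin d → ℤ, ∑' k : ℤ,
    if k ≠ 0 ∧ ((N : ℤ) ∣ ∑ j, h j * (g j : ℤ) + k * x) then auxP w h * w d k else 0

/-- Snoc equivalence. -/
def auxEquiv (d : ℕ) : (Fin d → ℤ) × ℤ ≃ (Fin (d + 1) → ℤ) where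
  toFun p := Fin.snoc (α := fun _ => ℤ) p.1 p.2
  invFun h := (fun j => h j.castSucc, h (Fin.last d))
  left_inv p := by ext <;> simp
  right_inv h := by
    ext j
    refine Fin.lastCases ?_ (fun i => ?_) j <;> simp

lemma aux_tsum_snoc {d : ℕ} (f : (Fin (d + 1) → ℤ) → ℝ≥0∞) :
    ∑' h, f h = ∑' h : Fin d → ℤ, ∑' k : ℤ, f (Fin.snoc (α := fun _ => ℤ) h k) := by
  rw [← (auxEquiv d).tsum_eq f, ENNReal.tsum_prod']
  rfl

lemma auxP_snoc (w : ℕ → ℤ → ℝ≥0∞) {d : ℕ} (h : Fin d → ℤ) (k : ℤ) :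
    auxP w (Fin.snoc (α := fun _ => ℤ) h k : Fin (d + 1) → ℤ) = auxP w h * w d k := by
  simp [auxP, Fin.prod_univ_castSucc]

lemma aux_tsum_P (w : ℕ → ℤ → ℝ≥0∞) (d : ℕ) :
    ∑' h : Fin d → ℤ, auxP w h = ∏ j ∈ Finset.range d, ∑' k, w j k := by
  induction d with
  | zero => simp [auxP]
  | succ d ih =>
    rw [aux_tsum_snoc, Finset.prod_range_succ, ← ih, ← ENNReal.tsum_mul_right]
    refine tsum_congr fun h => ?_
    rw [← ENNReal.tsum_mul_left]
    exact tsum_congr fun k => auxP_snoc w h k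

lemma auxS_snoc (w : ℕ → ℤ → ℝ≥0∞) (hw : ∀ j, w j 0 = 1) (N : ℕ) {d : ℕ} (g : Fin d → ℕ)
    (x : ℕ) :
    auxS w N (Fin.snoc (α := fun _ => ℕ) g x : Fin (d + 1) → ℕ) = auxS w N g + auxT w N g x := by
  unfold auxS auxT
  rw [aux_tsum_snoc, ← ENNReal.tsum_add]
  refine tsum_congr fun h => ?_
  rw [ENNReal.tsum_eq_add_tsum_ite (0 : ℤ)]
  have hz : ∀ k : ℤ, (Fin.snoc (α := fun _ => ℤ) h k : Fin (d + 1) → ℤ) = 0 ↔ h = 0 ∧ k = 0 := by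
    intro k
    constructor
    · intro e
      refine ⟨?_, ?_⟩
      · ext j
        have := congrFun e j.castSucc
        simpa using this
      · have := congrFun e (Fin.last d)
        simpa using this
    · rintro ⟨rfl, rfl⟩
      ext j
      refine Fin.lastCases ?_ (fun i => ?_) j <;> simp
  congr 1
  · simp [auxP_snoc, hw, hz, Fin.sum_univ_castSucc]
  · refine tsum_congr fun k => ?_
    by_cases hk : k = 0
    · simp [hk]
    · simp [auxP_snoc, hz, Fin.sum_univ_castSucc, hk]

lemma auxS_le (w : ℕ → ℤ → ℝ≥0∞) (N : ℕ) {d : ℕ} (g : Fin d → ℕ) :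
    auxS w N g ≤ ∏ j ∈ Finset.range d, ∑' k, w j k := by
  rw [← aux_tsum_P]
  refine ENNReal.tsum_le_tsum fun h => ?_
  split_ifs <;> simp

lemma auxT_rpow_le (w : ℕ → ℤ → ℝ≥0∞) (N : ℕ) {d : ℕ} (g : Fin d → ℕ) (x : ℕ)
    {p : ℝ} (hp : 0 < p) (hp1 : p ≤ 1) :
    auxT w N g x ^ p ≤ auxT (fun j k => w j k ^ p) N g x := by
  unfold auxT
  refine (aux_rpow_tsum_le _ hp hp1).trans (ENNReal.tsum_le_tsum fun h => ?_)
  refine (aux_rpow_tsum_le _ hp hp1).trans (ENNReal.tsum_le_tsum fun k => ?_)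
  split_ifs
  · rw [ENNReal.mul_rpow_of_nonneg _ _ hp.le]
    unfold auxP
    rw [ENNReal.prod_rpow_of_nonneg hp.le]
  · simp [hp]

/-- `|k|^{-β}` off zero. -/
noncomputable def auxV (β : ℝ) (k : ℤ) : ℝ≥0∞ :=
  if k = 0 then 0 else ENNReal.ofReal (|(k : ℝ)| ^ (-β))

lemma aux_tsum_V (β : ℝ) (hβ : 1 < β) :
    ∑' k, auxV β k = ENNReal.ofReal (2 * zetaR β) := by
  have hs : Summable (fun n : ℕ => ((n : ℝ) + 1) ^ (-β)) := by
    have := (summable_nat_add_iff 1).2 (Real.summable_nat_rpow.2 (by linarith : -β < -1))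
    simpa using this
  have h1 : ∑' n : ℕ, ENNReal.ofReal (((n : ℝ) + 1) ^ (-β)) = ENNReal.ofReal (zetaR β) := by
    rw [zetaR, ENNReal.ofReal_tsum_of_nonneg (fun n => by positivity) hs]
  rw [tsum_of_nat_of_neg_add_one ENNReal.summable ENNReal.summable,
    tsum_eq_zero_add' ENNReal.summable]
  have e1 : ∀ n : ℕ, auxV β ((n + 1 : ℕ) : ℤ) = ENNReal.ofReal (((n : ℝ) + 1) ^ (-β)) := by
    intro n
    have h0 : ((n + 1 : ℕ) : ℤ) ≠ 0 := by omega
    rw [auxV, if_neg h0]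
    congr 2
    push_cast
    exact abs_of_nonneg (by positivity)
  have e2 : ∀ n : ℕ, auxV β (-((n : ℤ) + 1)) = ENNReal.ofReal (((n : ℝ) + 1) ^ (-β)) := by
    intro n
    have h0 : (-((n : ℤ) + 1)) ≠ 0 := by omega
    rw [auxV, if_neg h0]
    congr 2
    push_cast
    rw [abs_neg]
    exact abs_of_nonneg (by positivity)
  rw [tsum_congr e1, tsum_congr e2, h1]
  have hz : 0 ≤ zetaR β := tsum_nonneg fun n => by positivity
  rw [two_mul, ENNReal.ofReal_add hz hz]
  simp [auxV]

lemma aux_count (N : ℕ) (hN : 0 < N) (a k : ℤ) :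
    ((ZN N).filter (fun x : ℕ => (N : ℤ) ∣ a + k * x)).card ≤ Int.gcd k N := by
  set c := Int.gcd k N with hc
  have hcpos : 0 < c := Int.gcd_pos_of_ne_zero_right _ (by exact_mod_cast hN.ne')
  obtain ⟨M, hM⟩ : c ∣ N := by exact_mod_cast (Int.gcd_dvd_right k (N : ℤ))
  have hMpos : 0 < M := Nat.pos_of_ne_zero (by rintro rfl; omega)
  obtain ⟨k', hk'⟩ : (c : ℤ) ∣ k := Int.gcd_dvd_left k (N : ℤ)
  have hcop : IsCoprime (M : ℤ) k' := by
    rw [Int.isCoprime_iff_gcd_eq_one, Int.gcd_comm]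
    have h1 : Int.gcd ((c : ℤ) * k') ((c : ℤ) * M) = c := by
      have e : (c : ℤ) * M = N := by exact_mod_cast hM.symm
      rw [← hk', e]
    rw [Int.gcd_mul_left] at h1
    simp only [Int.natAbs_natCast] at h1
    exact Nat.eq_of_mul_eq_mul_left hcpos (by omega)
  rw [← Finset.card_range c]
  refine Finset.card_le_card_of_injOn (fun x => x / M) ?_ ?_
  · intro x hx
    simp only [ZN, Finset.coe_filter, Finset.mem_filter, Finset.mem_range, Set.mem_ofPred_eq] at hx
    simp only [Finset.coe_range, Set.mem_Iio]
    rw [Nat.div_lt_iff_lt_mul hMpos]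
    omega
  · intro x hx y hy hxy
    simp only [Finset.coe_filter, Set.mem_ofPred_eq] at hx hy
    have h1 : (N : ℤ) ∣ k * ((x : ℤ) - y) := by
      have := dvd_sub hx.2 hy.2
      ring_nf at this ⊢
      exact this
    have h2 : (M : ℤ) ∣ k' * ((x : ℤ) - y) := by
      rw [hM, hk'] at h1
      push_cast at h1
      rw [mul_assoc] at h1
      exact Int.dvd_of_mul_dvd_mul_left (by exact_mod_cast hcpos.ne') h1
    have h3 : (M : ℤ) ∣ (x : ℤ) - y := hcop.dvd_of_dvd_mul_left h2
    have h4 : y ≡ x [MOD M] := (Nat.modEq_iff_dvd).2 h3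
    have h5 : y % M = x % M := h4
    have h6 : x / M = y / M := hxy
    rw [← Nat.div_add_mod x M, ← Nat.div_add_mod y M, h5, h6]

lemma aux_dvd (N : ℕ) (a k : ℤ) (x : ℕ) (hx : x ∈ ZN N) (h : (N : ℤ) ∣ a + k * x) :
    ((Int.gcd a N : ℕ) : ℤ) ∣ k ∧ Int.gcd k N ∣ Int.gcd a N := by
  have hcop : IsCoprime (x : ℤ) (N : ℤ) := by
    rw [Nat.isCoprime_iff_coprime]
    exact (Finset.mem_filter.1 hx).2
  have ha1 := Int.gcd_dvd_left a (N : ℤ)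
  have ha2 := Int.gcd_dvd_right a (N : ℤ)
  have hk1 := Int.gcd_dvd_left k (N : ℤ)
  have hk2 := Int.gcd_dvd_right k (N : ℤ)
  constructor
  · have h1 : ((Int.gcd a N : ℕ) : ℤ) ∣ k * x := (dvd_add_right ha1).1 (ha2.trans h)
    exact (hcop.of_isCoprime_of_dvd_right ha2).symm.dvd_of_dvd_mul_right h1
  · have h1 : ((Int.gcd k N : ℕ) : ℤ) ∣ a :=
      (dvd_add_left (hk1.mul_right _)).1 (hk2.trans h)
    exact_mod_cast Int.dvd_coe_gcd h1 hk2

lemma aux_key (N : ℕ) (hN : 0 < N) (β : ℝ) (hβ : 1 < β) (a : ℤ) :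
    ∑ x ∈ ZN N, ∑' k : ℤ, (if k ≠ 0 ∧ (N : ℤ) ∣ a + k * x then auxV β k else 0)
      ≤ ∑' k, auxV β k := by
  set c := Int.gcd a N with hc
  have hcpos : 0 < c := Int.gcd_pos_of_ne_zero_right _ (by exact_mod_cast hN.ne')
  rw [← Summable.tsum_finsetSum (fun _ _ => ENNReal.summable)]
  have step : ∀ k : ℤ, ∑ x ∈ ZN N, (if k ≠ 0 ∧ (N : ℤ) ∣ a + k * x then auxV β k else 0)
      ≤ if (c : ℤ) ∣ k then (c : ℝ≥0∞) * auxV β k else 0 := by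
    intro k
    have h1 : ∑ x ∈ ZN N, (if k ≠ 0 ∧ (N : ℤ) ∣ a + k * x then auxV β k else 0)
        ≤ ((ZN N).filter (fun x : ℕ => (N : ℤ) ∣ a + k * x)).card * auxV β k := by
      rw [← nsmul_eq_mul, ← Finset.sum_const, Finset.sum_filter]
      refine Finset.sum_le_sum fun x _ => ?_
      by_cases h : (N : ℤ) ∣ a + k * x <;> by_cases hk : k = 0 <;> simp [h, hk]
    refine h1.trans ?_
    rcases Finset.eq_empty_or_nonempty ((ZN N).filter (fun x : ℕ => (N : ℤ) ∣ a + k * x))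
      with he | ⟨x, hx⟩
    · simp [he]
    · obtain ⟨hx1, hx2⟩ := Finset.mem_filter.1 hx
      obtain ⟨hd1, hd2⟩ := aux_dvd N a k x hx1 hx2
      rw [if_pos hd1]
      gcongr
      exact (aux_count N hN a k).trans (Nat.le_of_dvd hcpos hd2)
  refine (ENNReal.tsum_le_tsum step).trans ?_
  have hinj : Function.Injective (fun m : ℤ => (c : ℤ) * m) :=
    mul_right_injective₀ (by exact_mod_cast hcpos.ne')
  rw [← hinj.tsum_eq (f := fun k : ℤ => if (c : ℤ) ∣ k then (c : ℝ≥0∞) * auxV β k else 0)]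
  · refine ENNReal.tsum_le_tsum fun m => ?_
    simp only [dvd_mul_right, if_true]
    unfold auxV
    by_cases hm : m = 0
    · simp [hm]
    · rw [if_neg hm, if_neg (mul_ne_zero (by exact_mod_cast hcpos.ne') hm)]
      rw [← ENNReal.ofReal_natCast, ← ENNReal.ofReal_mul (by positivity)]
      apply ENNReal.ofReal_le_ofReal
      push_cast
      have hc1 : (1 : ℝ) ≤ c := by exact_mod_cast hcpos
      rw [abs_mul, Real.mul_rpow (abs_nonneg _) (abs_nonneg _), ← mul_assoc,
        abs_of_nonneg (by positivity : (0 : ℝ) ≤ c)]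
      refine mul_le_of_le_one_left (by positivity) ?_
      calc (c : ℝ) * (c : ℝ) ^ (-β) = (c : ℝ) ^ (1 + -β) := by
            rw [Real.rpow_add (by positivity), Real.rpow_one]
        _ ≤ 1 := Real.rpow_le_one_of_one_le_of_nonpos hc1 (by linarith)
  · intro k hk
    simp only [Function.mem_support, ne_eq, ite_eq_right_iff, not_forall] at hk
    obtain ⟨⟨m, rfl⟩, _⟩ := hk
    exact ⟨m, rfl⟩

/-- Coordinate weights. -/
noncomputable def auxW (c : ℕ → ℝ≥0∞) (β : ℝ) (j : ℕ) (k : ℤ) : ℝ≥0∞ :=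
  if k = 0 then 1 else c j * auxV β k

lemma aux_tsum_W (c : ℕ → ℝ≥0∞) (β : ℝ) (j : ℕ) :
    ∑' k, auxW c β j k = 1 + c j * ∑' k, auxV β k := by
  rw [ENNReal.tsum_eq_add_tsum_ite (0 : ℤ), ← ENNReal.tsum_mul_left]
  have h0 : auxW c β j 0 = 1 := by simp [auxW]
  rw [h0]
  congr 1
  · refine tsum_congr fun k => ?_
    by_cases hk : k = 0 <;> simp [auxW, auxV, hk]

lemma auxW_rpow (γ : ℕ → ℝ) (hγ : ∀ j, 0 ≤ γ j) (α lam : ℝ) (hl : 0 < lam) :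
    (fun j k => auxW (fun j => ENNReal.ofReal (γ (j + 1))) α j k ^ lam)
      = auxW (fun j => ENNReal.ofReal (γ (j + 1) ^ lam)) (α * lam) := by
  funext j k
  unfold auxW auxV
  by_cases hk : k = 0
  · simp [hk]
  · simp only [if_neg hk]
    rw [ENNReal.mul_rpow_of_nonneg _ _ hl.le, ENNReal.ofReal_rpow_of_nonneg (hγ _) hl.le,
      ENNReal.ofReal_rpow_of_nonneg (by positivity) hl.le, ← Real.rpow_mul (abs_nonneg _)]
    congr 3
    ring

lemma aux_sum_T (c : ℕ → ℝ≥0∞) (N : ℕ) (hN : 0 < N) (β : ℝ) (hβ : 1 < β) {d : ℕ}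
    (g : Fin d → ℕ) :
    ∑ x ∈ ZN N, auxT (auxW c β) N g x
      ≤ (c d * ∑' k, auxV β k) * ∏ j ∈ Finset.range d, (1 + c j * ∑' k, auxV β k) := by
  unfold auxT
  rw [← Summable.tsum_finsetSum (fun _ _ => ENNReal.summable)]
  simp_rw [← aux_tsum_W]
  rw [← aux_tsum_P, ← ENNReal.tsum_mul_left]
  refine ENNReal.tsum_le_tsum fun h => ?_
  have e : ∀ x : ℕ, (∑' k : ℤ, if k ≠ 0 ∧ ((N : ℤ) ∣ ∑ j, h j * (g j : ℤ) + k * x)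
        then auxP (auxW c β) h * auxW c β d k else 0)
      = (auxP (auxW c β) h * c d) * ∑' k : ℤ,
        if k ≠ 0 ∧ ((N : ℤ) ∣ ∑ j, h j * (g j : ℤ) + k * x) then auxV β k else 0 := by
    intro x
    rw [← ENNReal.tsum_mul_left]
    refine tsum_congr fun k => ?_
    split_ifs with hk
    · rw [auxW, if_neg hk.1, mul_assoc]
    · simp
  simp_rw [e]
  rw [← Finset.mul_sum]
  calc _ ≤ (auxP (auxW c β) h * c d) * ∑' k, auxV β k := by
        gcongr
        exact aux_key N hN β hβ _
    _ = _ := by ring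

lemma aux_rpw (α : ℝ) (γ : ℕ → ℝ) (hγ : ∀ j, 0 ≤ γ j) {d : ℕ} (h : Fin d → ℤ) :
    rpw α γ h = (auxP (auxW (fun j => ENNReal.ofReal (γ (j + 1))) α) h).toReal := by
  unfold rpw auxP
  rw [Finset.prod_filter, ENNReal.toReal_prod]
  refine Finset.prod_congr rfl fun j _ => ?_
  by_cases hj : h j = 0
  · simp [hj, auxW]
  · simp only [auxW, auxV, hj, if_false, ne_eq, not_false_eq_true, if_true]
    rw [ENNReal.toReal_mul, ENNReal.toReal_ofReal (hγ _), ENNReal.toReal_ofReal (by positivity)]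

lemma auxW_ne_top (γ : ℕ → ℝ) (α : ℝ) (j : ℕ) (k : ℤ) :
    auxW (fun j => ENNReal.ofReal (γ (j + 1))) α j k ≠ ∞ := by
  unfold auxW auxV
  split_ifs
  · simp
  · exact ENNReal.mul_ne_top ENNReal.ofReal_ne_top ENNReal.ofReal_ne_top

lemma aux_err2 (N : ℕ) (α : ℝ) (γ : ℕ → ℝ) (hγ : ∀ j, 0 ≤ γ j) {d : ℕ} (g : Fin d → ℕ) :
    err2 N α γ g = (auxS (auxW (fun j => ENNReal.ofReal (γ (j + 1))) α) N g).toReal := by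
  unfold err2 auxS
  rw [ENNReal.tsum_toReal_eq]
  · refine tsum_congr fun h => ?_
    split_ifs
    · exact aux_rpw α γ hγ h
    · simp
  · intro h
    split_ifs
    · exact ENNReal.prod_ne_top fun j _ => auxW_ne_top γ α _ _
    · simp

lemma auxS_ne_top (N : ℕ) (α : ℝ) (hα : 1 < α) (γ : ℕ → ℝ) {d : ℕ} (g : Fin d → ℕ) :
    auxS (auxW (fun j => ENNReal.ofReal (γ (j + 1))) α) N g ≠ ∞ := by
  refine ne_top_of_le_ne_top ?_ (auxS_le _ N g)
  refine ENNReal.prod_ne_top fun j _ => ?_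
  rw [aux_tsum_W, aux_tsum_V α hα]
  exact ENNReal.add_ne_top.2 ⟨by simp, ENNReal.mul_ne_top ENNReal.ofReal_ne_top ENNReal.ofReal_ne_top⟩

lemma aux_card_ZN (N : ℕ) : (ZN N).card = N.totient := by
  unfold ZN Nat.totient
  congr 1
  ext x
  simp [Nat.coprime_comm]

lemma aux_main (N s : ℕ) (hN : 2 ≤ N)
    (α : ℝ) (hα : 1 < α) (γ : ℕ → ℝ) (hγ : ∀ j, 0 ≤ γ j)
    (gs : Fin s → ℕ) (E : ℕ → Finset ℕ)
    (hE' : ∀ j, j + 1 ≤ s → E (j + 1) ⊆ ZN N ∧ (E (j + 1)).card < N.totient)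
    (hmin : ∀ d : ℕ, ∀ hd : d + 1 ≤ s, ∀ g ∈ ZN N \ E (d + 1),
      err2 N α γ (fun j : Fin (d + 1) => gs (Fin.castLE hd j))
        ≤ err2 N α γ (Fin.snoc (fun j : Fin d => gs (Fin.castLE (Nat.le_of_succ_le hd) j)) g))
    (lam : ℝ) (hl : 1 / α < lam) (hl1 : lam ≤ 1) :
    ∀ d : ℕ, ∀ hds : d ≤ s,
      err2 N α γ (fun j : Fin d => gs (Fin.castLE hds j)) ^ lam
        ≤ (1 / (N.totient : ℝ)) * ∏ j ∈ Finset.range d, (1 +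
            γ (j + 1) ^ lam * (2 * zetaR (α * lam))
              * ((N.totient : ℝ) / ((N.totient : ℝ) - ((E (j + 1)).card : ℝ)))) := by
  have hl0 : 0 < lam := lt_trans (by positivity) hl
  have hβ : 1 < α * lam := by
    rw [div_lt_iff₀ (by linarith)] at hl
    linarith
  have hφ : 0 < N.totient := Nat.totient_pos.2 (by omega)
  have hφ' : (0 : ℝ) < N.totient := by exact_mod_cast hφ
  have hζ : 0 ≤ 2 * zetaR (α * lam) :=
    mul_nonneg zero_le_two (tsum_nonneg fun n => by positivity)
  set Z := 2 * zetaR (α * lam) with hZ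
  intro d
  induction d with
  | zero =>
    intro hds
    have : err2 N α γ (fun j : Fin 0 => gs (Fin.castLE hds j)) = 0 := by
      unfold err2
      refine (tsum_congr fun h => ?_).trans tsum_zero
      rw [if_neg]
      exact fun hh => hh.1 (Subsingleton.elim _ _)
    rw [this, Real.zero_rpow hl0.ne']
    simp
  | succ d ih =>
    intro hds
    have ihd := ih (Nat.le_of_succ_le hds)
    set w := auxW (fun j => ENNReal.ofReal (γ (j + 1))) α with hw
    have hw0 : ∀ j, w j 0 = 1 := fun j => by simp [hw, auxW]
    set g0 : Fin d → ℕ := fun j : Fin d => gs (Fin.castLE (Nat.le_of_succ_le hds) j) with hg0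
    have hsn : (fun j : Fin (d + 1) => gs (Fin.castLE hds j))
        = Fin.snoc (α := fun _ => ℕ) g0 (gs ⟨d, hds⟩) := by
      funext j
      refine Fin.lastCases ?_ (fun i => ?_) j
      · rw [Fin.snoc_last]; rfl
      · rw [Fin.snoc_castSucc]; rfl
    set T : ℕ → ℝ≥0∞ := fun x => auxT w N g0 x with hT
    have hS : ∀ x : ℕ, err2 N α γ (Fin.snoc (α := fun _ => ℕ) g0 x : Fin (d + 1) → ℕ)
        = err2 N α γ g0 + (T x).toReal := by
      intro x
      have hne := auxS_ne_top N α hα γ (Fin.snoc (α := fun _ => ℕ) g0 x : Fin (d + 1) → ℕ)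
      rw [aux_err2 N α γ hγ, aux_err2 N α γ hγ]
      rw [auxS_snoc _ hw0] at hne ⊢
      rw [ENNReal.add_ne_top] at hne
      exact ENNReal.toReal_add hne.1 hne.2
    have hTne : ∀ x, T x ≠ ∞ := by
      intro x
      have hne := auxS_ne_top N α hα γ (Fin.snoc (α := fun _ => ℕ) g0 x : Fin (d + 1) → ℕ)
      rw [auxS_snoc _ hw0, ENNReal.add_ne_top] at hne
      exact hne.2
    set t := (T (gs ⟨d, hds⟩)).toReal with ht
    have ht0 : 0 ≤ t := ENNReal.toReal_nonneg
    have hmin' : ∀ x ∈ ZN N \ E (d + 1), ENNReal.ofReal t ≤ T x := by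
      intro x hx
      have h1 := hmin d hds x hx
      rw [hsn] at h1
      have h2 : err2 N α γ g0 + t ≤ err2 N α γ g0 + (T x).toReal := by
        rw [ht, ← hS, ← hS]
        exact h1
      rw [← ENNReal.ofReal_toReal (hTne x)]
      exact ENNReal.ofReal_le_ofReal (by linarith)
    obtain ⟨hEs, hEc⟩ := hE' d hds
    have hEc' : (0 : ℝ) < (N.totient : ℝ) - ((E (d + 1)).card : ℝ) := by
      have : ((E (d + 1)).card : ℝ) < N.totient := by exact_mod_cast hEc
      linarith
    have hsum : ((N.totient : ℝ) - ((E (d + 1)).card : ℝ)) * t ^ lam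
        ≤ γ (d + 1) ^ lam * Z * ∏ j ∈ Finset.range d, (1 + γ (j + 1) ^ lam * Z) := by
      have hpos : ∀ j, 0 ≤ γ (j + 1) ^ lam * Z := fun j =>
        mul_nonneg (Real.rpow_nonneg (hγ _) _) hζ
      have hprod : 0 ≤ ∏ j ∈ Finset.range d, (1 + γ (j + 1) ^ lam * Z) :=
        Finset.prod_nonneg fun j _ => by linarith [hpos j]
      rw [← ENNReal.ofReal_le_ofReal_iff (mul_nonneg (hpos d) hprod)]
      have hc : (N.totient : ℝ) - ((E (d + 1)).card : ℝ) = ((ZN N \ E (d + 1)).card : ℝ) := by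
        rw [Finset.card_sdiff_of_subset hEs, aux_card_ZN, Nat.cast_sub hEc.le]
      rw [hc, ENNReal.ofReal_mul (Nat.cast_nonneg _), ENNReal.ofReal_natCast,
        ← ENNReal.ofReal_rpow_of_nonneg ht0 hl0.le, ← nsmul_eq_mul, ← Finset.sum_const]
      calc ∑ x ∈ ZN N \ E (d + 1), ENNReal.ofReal t ^ lam
          ≤ ∑ x ∈ ZN N \ E (d + 1), T x ^ lam :=
            Finset.sum_le_sum fun x hx => ENNReal.rpow_le_rpow (hmin' x hx) hl0.le
        _ ≤ ∑ x ∈ ZN N, T x ^ lam :=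
            Finset.sum_le_sum_of_subset Finset.sdiff_subset
        _ ≤ ∑ x ∈ ZN N, auxT (fun j k => w j k ^ lam) N g0 x :=
            Finset.sum_le_sum fun x _ => auxT_rpow_le w N g0 x hl0 hl1
        _ ≤ _ := by
            rw [hw, auxW_rpow γ hγ α lam hl0]
            refine (aux_sum_T _ N (by omega) _ hβ g0).trans_eq ?_
            rw [aux_tsum_V _ hβ, ENNReal.ofReal_mul (hpos d),
              ENNReal.ofReal_mul (Real.rpow_nonneg (hγ _) _),
              ENNReal.ofReal_prod_of_nonneg (fun j _ => by linarith [hpos j])]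
            congr 1
            refine Finset.prod_congr rfl fun j _ => ?_
            rw [ENNReal.ofReal_add zero_le_one (hpos j),
              ENNReal.ofReal_mul (Real.rpow_nonneg (hγ _) _), ENNReal.ofReal_one]
    have he0 : 0 ≤ err2 N α γ g0 := by
      rw [aux_err2 N α γ hγ]; exact ENNReal.toReal_nonneg
    rw [hsn, hS, Finset.prod_range_succ]
    have hadd := Real.rpow_add_le_add_rpow he0 ht0 hl0.le hl1
    have hmono : ∏ j ∈ Finset.range d, (1 + γ (j + 1) ^ lam * Z)
        ≤ ∏ j ∈ Finset.range d, (1 + γ (j + 1) ^ lam * Z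
          * ((N.totient : ℝ) / ((N.totient : ℝ) - ((E (j + 1)).card : ℝ)))) := by
      refine Finset.prod_le_prod (fun j _ => ?_) fun j hj => ?_
      · have := mul_nonneg (Real.rpow_nonneg (hγ (j + 1)) lam) hζ
        linarith
      · have := mul_nonneg (Real.rpow_nonneg (hγ (j + 1)) lam) hζ
        have hj' := (hE' j (by have := Finset.mem_range.1 hj; omega)).2
        have hj'' : ((E (j + 1)).card : ℝ) < N.totient := by exact_mod_cast hj'
        have h1 : 1 ≤ (N.totient : ℝ) / ((N.totient : ℝ) - ((E (j + 1)).card : ℝ)) := by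
          rw [one_le_div (by linarith)]
          have : (0 : ℝ) ≤ ((E (j + 1)).card : ℝ) := Nat.cast_nonneg _
          linarith
        have := le_mul_of_one_le_right this h1
        linarith
    set Q := ∏ j ∈ Finset.range d, (1 + γ (j + 1) ^ lam * Z
          * ((N.totient : ℝ) / ((N.totient : ℝ) - ((E (j + 1)).card : ℝ)))) with hQ
    have hX : 0 ≤ γ (d + 1) ^ lam * Z := mul_nonneg (Real.rpow_nonneg (hγ _) _) hζ
    have h3 : ((N.totient : ℝ) - ((E (d + 1)).card : ℝ)) * t ^ lam ≤ γ (d + 1) ^ lam * Z * Q :=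
      hsum.trans (mul_le_mul_of_nonneg_left hmono hX)
    have h4 : t ^ lam ≤ γ (d + 1) ^ lam * Z * Q / ((N.totient : ℝ) - ((E (d + 1)).card : ℝ)) := by
      rw [le_div_iff₀ hEc']; linarith
    have h5 : 1 / (N.totient : ℝ) * (Q * (1 + γ (d + 1) ^ lam * Z
          * ((N.totient : ℝ) / ((N.totient : ℝ) - ((E (d + 1)).card : ℝ)))))
        = 1 / (N.totient : ℝ) * Q
          + γ (d + 1) ^ lam * Z * Q / ((N.totient : ℝ) - ((E (d + 1)).card : ℝ)) := by
      field_simp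
    rw [h5]
    linarith

theorem projection_corrected_cbc_error_bound (N s : ℕ) (hN : 2 ≤ N) (hs : 1 ≤ s)
    (α : ℝ) (hα : 1 < α) (γ : ℕ → ℝ) (hγ : ∀ j, 0 ≤ γ j)
    (gs : Fin s → ℕ) (E : ℕ → Finset ℕ)
    (hE1 : E 1 = ∅) (hE : ∀ j, 2 ≤ j → j ≤ s → E j ⊂ ZN N)
    (hg1 : gs ⟨0, hs⟩ = 1)
    (hgmem : ∀ d : ℕ, ∀ hd : d + 1 ≤ s, gs ⟨d, hd⟩ ∈ ZN N \ E (d + 1))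
    (hmin : ∀ d : ℕ, ∀ hd : d + 1 ≤ s, ∀ g ∈ ZN N \ E (d + 1),
      err2 N α γ (fun j : Fin (d + 1) => gs (Fin.castLE hd j))
        ≤ err2 N α γ (Fin.snoc (fun j : Fin d => gs (Fin.castLE (Nat.le_of_succ_le hd) j)) g)) :
    ∀ d : ℕ, 1 ≤ d → ∀ hds : d ≤ s, ∀ lam : ℝ, 1 / α < lam → lam ≤ 1 →
      err2 N α γ (fun j : Fin d => gs (Fin.castLE hds j))
        ≤ ((1 / (N.totient : ℝ)) * ∑ u ∈ (Finset.range d).powerset,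
            (∏ j ∈ u, γ (j + 1) ^ lam) * (2 * zetaR (α * lam)) ^ u.card
              * ∏ j ∈ u, (N.totient : ℝ) / ((N.totient : ℝ) - ((E (j + 1)).card : ℝ)))
          ^ (1 / lam) := by
  intro d hd1 hds lam hl hl1
  have hl0 : 0 < lam := lt_trans (by positivity) hl
  have hE' : ∀ j, j + 1 ≤ s → E (j + 1) ⊆ ZN N ∧ (E (j + 1)).card < N.totient := by
    intro j hj
    have hsub : E (j + 1) ⊆ ZN N := by
      rcases Nat.eq_zero_or_pos j with rfl | hjp
      · simp [hE1]
      · exact (hE (j + 1) (by omega) hj).1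
    refine ⟨hsub, ?_⟩
    rw [← aux_card_ZN]
    refine Finset.card_lt_card (Finset.ssubset_iff_subset_ne.2 ⟨hsub, fun h => ?_⟩)
    have := hgmem j hj
    rw [h] at this
    simp at this
  have key := aux_main N s hN α hα γ hγ gs E hE' hmin lam hl hl1 d hds
  have he0 : 0 ≤ err2 N α γ (fun j : Fin d => gs (Fin.castLE hds j)) := by
    rw [aux_err2 N α γ hγ]; exact ENNReal.toReal_nonneg
  have hsum : ∑ u ∈ (Finset.range d).powerset,
            (∏ j ∈ u, γ (j + 1) ^ lam) * (2 * zetaR (α * lam)) ^ u.card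
              * ∏ j ∈ u, (N.totient : ℝ) / ((N.totient : ℝ) - ((E (j + 1)).card : ℝ))
      = ∏ j ∈ Finset.range d, (1 +
            γ (j + 1) ^ lam * (2 * zetaR (α * lam))
              * ((N.totient : ℝ) / ((N.totient : ℝ) - ((E (j + 1)).card : ℝ)))) := by
    rw [Finset.prod_one_add]
    refine Finset.sum_congr rfl fun u _ => ?_
    rw [Finset.prod_mul_distrib, Finset.prod_mul_distrib, Finset.prod_const]
  rw [hsum]
  have h := Real.rpow_le_rpow (Real.rpow_nonneg he0 _) key (by positivity : 0 ≤ 1 / lam)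
  rwa [← Real.rpow_mul he0, mul_one_div_cancel hl0.ne', Real.rpow_one] at h
end

section
/- Let $(N_k)_{k\in\mathbb{N}}$ and $(s_k)_{k\in\mathbb{N}}$ be sequences of positive integers with $N_k \ge 2$, and for each $k$ let $g^*_k = (g^*_{1,k},\ldots,g^*_{s_k,k})$ be constructed by the projection-corrected component-by-component algorithm with exclusion sets $\mathcal{E}_2^{(k)},\ldots,\mathcal{E}_{s_k}^{(k)} \subsetneq \mathcal{Z}_{N_k}$ (i.e., $g^*_{1,k}=1$ and each $g^*_{d+1,k}$ minimizes $e^2(g^*_{1,k},\ldots,g^*_{d,k},g)$ over $g \in \mathcal{Z}_{N_k}\setminus\mathcal{E}_{d+1}^{(k)}$). Suppose there exists $0 < \delta < 1$ such that $\sup_{k\in\mathbb{N}} \max_{2\le d\le s_k} |\mathcal{E}_d^{(k)}| / \varphi(N_k) \le \delta$. Then for every $k \in \mathbb{N}$ and every real $\lambda$ with $1/\alpha < \lambda \le 1$, $$e^2(g^*_k) \le \left(\frac{1}{\varphi(N_k)} \sum_{u \subseteq \{1,\ldots,s_k\}} \gamma_u^\lambda \left(\frac{2\zeta(\alpha\lambda)}{1-\delta}\right)^{|u|}\right)^{1/\lambda}.$$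 -/
open Finset
open scoped Classical

namespace CBC
open ENNReal

/-- one-dimensional power term -/
noncomputable def pw (x : ℝ) (a : ℤ) : ℝ≥0∞ := ENNReal.ofReal (|(a : ℝ)| ^ (-x))

noncomputable def w (x : ℝ) (c : ℝ≥0∞) (a : ℤ) : ℝ≥0∞ := if a = 0 then 1 else c * pw x a

noncomputable def R {d : ℕ} (x : ℝ) (c : ℕ → ℝ≥0∞) (h : Fin d → ℤ) : ℝ≥0∞ :=
  ∏ j : Fin d, w x (c j) (h j)

noncomputable def Z (x : ℝ) : ℝ≥0∞ := ∑' a : ℤ, if a ≠ 0 then pw x a else 0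

noncomputable def errE {d : ℕ} (N : ℕ) (x : ℝ) (c : ℕ → ℝ≥0∞) (g : Fin d → ℕ) : ℝ≥0∞ :=
  ∑' h : Fin d → ℤ, if h ≠ 0 ∧ ((N : ℤ) ∣ ∑ j, h j * (g j : ℤ)) then R x c h else 0

noncomputable def thE {d : ℕ} (N : ℕ) (x : ℝ) (c : ℕ → ℝ≥0∞) (gs : Fin d → ℕ) (g : ℕ) : ℝ≥0∞ :=
  ∑' h : Fin d → ℤ, ∑' a : ℤ,
    if a ≠ 0 ∧ ((N : ℤ) ∣ (∑ j, h j * (gs j : ℤ)) + a * (g : ℤ)) then R x c h * (c d * pw x a) else 0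

lemma ofReal_rpw {d : ℕ} (α : ℝ) (γ : ℕ → ℝ) (hγ : ∀ j, 0 ≤ γ j) (h : Fin d → ℤ) :
    ENNReal.ofReal (rpw α γ h) = R α (fun j => ENNReal.ofReal (γ (j + 1))) h := by
  unfold rpw R
  rw [Finset.prod_filter, ENNReal.ofReal_prod_of_nonneg]
  · apply Finset.prod_congr rfl
    intro j _
    unfold w pw
    by_cases hj : h j = 0
    · simp [hj]
    · simp [hj, ENNReal.ofReal_mul (hγ _)]
  · intro j _
    split_ifs
    · exact mul_nonneg (hγ _) (by positivity)
    · norm_num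

lemma rpw_nonneg {d : ℕ} (α : ℝ) (γ : ℕ → ℝ) (hγ : ∀ j, 0 ≤ γ j) (h : Fin d → ℤ) :
    0 ≤ rpw α γ h :=
  Finset.prod_nonneg fun j _ => mul_nonneg (hγ _) (by positivity)

lemma err2_eq {d : ℕ} (N : ℕ) (α : ℝ) (γ : ℕ → ℝ) (hγ : ∀ j, 0 ≤ γ j) (g : Fin d → ℕ) :
    err2 N α γ g = (errE N α (fun j => ENNReal.ofReal (γ (j + 1))) g).toReal := by
  unfold err2 errE
  rw [ENNReal.tsum_toReal_eq]
  · apply tsum_congr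
    intro h
    split_ifs
    · rw [← ofReal_rpw α γ hγ, ENNReal.toReal_ofReal (rpw_nonneg α γ hγ h)]
    · simp
  · intro h
    split_ifs
    · rw [← ofReal_rpw α γ hγ]; exact ENNReal.ofReal_ne_top
    · simp

lemma tsum_snoc {d : ℕ} (f : (Fin (d + 1) → ℤ) → ℝ≥0∞) :
    ∑' h, f h = ∑' h : Fin d → ℤ, ∑' a : ℤ, f (Fin.snoc h a) := by
  rw [← (Fin.snocEquiv (fun _ : Fin (d + 1) => ℤ)).tsum_eq, ENNReal.tsum_comm]
  exact ENNReal.tsum_prod (f := fun a h => f (Fin.snoc h a))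

lemma R_snoc {d : ℕ} (x : ℝ) (c : ℕ → ℝ≥0∞) (h : Fin d → ℤ) (a : ℤ) :
    R x c (Fin.snoc h a : Fin (d + 1) → ℤ) = R x c h * w x (c d) a := by
  unfold R
  rw [Fin.prod_univ_castSucc]
  simp

lemma tsum_split (f : ℤ → ℝ≥0∞) : ∑' a, f a = f 0 + ∑' a, if a ≠ 0 then f a else 0 := by
  rw [ENNReal.tsum_eq_add_tsum_ite 0]
  congr 1
  apply tsum_congr
  intro a
  by_cases h : a = 0 <;> simp [h]

lemma tsum_w (x : ℝ) (c : ℝ≥0∞) : ∑' a, w x c a = 1 + c * Z x := by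
  rw [tsum_split, Z, ← ENNReal.tsum_mul_left]
  congr 1
  apply tsum_congr
  intro a
  by_cases h : a = 0 <;> simp [w, h]

lemma tsum_R (x : ℝ) (c : ℕ → ℝ≥0∞) (d : ℕ) :
    ∑' h : Fin d → ℤ, R x c h = ∏ j ∈ Finset.range d, (1 + c j * Z x) := by
  induction d with
  | zero => rw [tsum_eq_single default (fun b hb => (hb (Subsingleton.elim _ _)).elim)]; simp [R]
  | succ d ih =>
    rw [tsum_snoc, Finset.prod_range_succ, ← ih, ← ENNReal.tsum_mul_right]
    apply tsum_congr
    intro h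
    simp_rw [R_snoc, ENNReal.tsum_mul_left, tsum_w]

lemma errE_snoc {d : ℕ} (N : ℕ) (x : ℝ) (c : ℕ → ℝ≥0∞) (gs : Fin d → ℕ) (g : ℕ) :
    errE N x c (Fin.snoc gs g : Fin (d + 1) → ℕ) = errE N x c gs + thE N x c gs g := by
  unfold errE thE
  rw [tsum_snoc, ← ENNReal.tsum_add]
  apply tsum_congr
  intro h
  rw [tsum_split]
  simp_rw [R_snoc, Fin.sum_univ_castSucc]
  congr 1
  · have : (Fin.snoc h 0 : Fin (d + 1) → ℤ) = 0 ↔ h = 0 := by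
      constructor
      · intro H; funext j
        have := congrFun H j.castSucc
        simpa using this
      · rintro rfl; funext j
        refine Fin.lastCases ?_ (fun i => ?_) j <;> simp
    simp [this, w]
  · apply tsum_congr
    intro a
    by_cases ha : a = 0
    · simp [ha]
    · have : (Fin.snoc h a : Fin (d + 1) → ℤ) ≠ 0 := by
        intro H
        have := congrFun H (Fin.last d)
        simp at this
        exact ha this
      simp [this, w, ha]

lemma rpow_sum_le {ι : Type*} (s : Finset ι) (f : ι → ℝ≥0∞) (l : ℝ) (h0 : 0 < l) (h1 : l ≤ 1) :
    (∑ i ∈ s, f i) ^ l ≤ ∑ i ∈ s, f i ^ l := by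
  induction s using Finset.induction_on with
  | empty => simp [h0]
  | insert a s ha ih =>
    rw [Finset.sum_insert ha, Finset.sum_insert ha]
    exact (ENNReal.rpow_add_le_add_rpow _ _ h0.le h1).trans (by gcongr)

lemma rpow_tsum_le {ι : Type*} (f : ι → ℝ≥0∞) (l : ℝ) (h0 : 0 < l) (h1 : l ≤ 1) :
    (∑' i, f i) ^ l ≤ ∑' i, f i ^ l := by
  rw [← ENNReal.le_rpow_inv_iff h0, ENNReal.tsum_eq_iSup_sum]
  refine iSup_le fun s => ?_
  rw [ENNReal.le_rpow_inv_iff h0]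
  exact (rpow_sum_le s f l h0 h1).trans (ENNReal.sum_le_tsum s)

lemma pw_rpow (x l : ℝ) (h0 : 0 < l) (a : ℤ) : pw x a ^ l = pw (x * l) a := by
  unfold pw
  rw [ENNReal.ofReal_rpow_of_nonneg (by positivity) h0.le, ← Real.rpow_mul (abs_nonneg _), neg_mul]

lemma R_rpow {d : ℕ} (x l : ℝ) (h0 : 0 < l) (c : ℕ → ℝ≥0∞) (h : Fin d → ℤ) :
    R x c h ^ l = R (x * l) (fun j => c j ^ l) h := by
  unfold R
  rw [← ENNReal.prod_rpow_of_nonneg h0.le]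
  apply Finset.prod_congr rfl
  intro j _
  unfold w
  split_ifs
  · simp
  · rw [ENNReal.mul_rpow_of_nonneg _ _ h0.le, pw_rpow x l h0]

lemma thE_rpow_le {d : ℕ} (N : ℕ) (x l : ℝ) (h0 : 0 < l) (h1 : l ≤ 1) (c : ℕ → ℝ≥0∞)
    (gs : Fin d → ℕ) (g : ℕ) :
    thE N x c gs g ^ l ≤ thE N (x * l) (fun j => c j ^ l) gs g := by
  unfold thE
  refine (rpow_tsum_le _ l h0 h1).trans (ENNReal.tsum_le_tsum fun h => ?_)
  refine (rpow_tsum_le _ l h0 h1).trans (ENNReal.tsum_le_tsum fun a => ?_)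
  split_ifs
  · rw [ENNReal.mul_rpow_of_nonneg _ _ h0.le, ENNReal.mul_rpow_of_nonneg _ _ h0.le, R_rpow x l h0,
      pw_rpow x l h0]
  · simp [h0]

lemma count_le (N : ℕ) (hN : 0 < N) (c a : ℤ) :
    ((ZN N).filter (fun g : ℕ => (N : ℤ) ∣ c + a * (g : ℤ))).card ≤ Int.gcd a N := by
  set t := Int.gcd a N with ht
  have htpos : 0 < t := Int.gcd_pos_of_ne_zero_right _ (by positivity)
  obtain ⟨m, hm⟩ : t ∣ N := by
    have := Int.gcd_dvd_right a (N : ℤ)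
    exact_mod_cast this
  have hmpos : 0 < m := by
    rcases Nat.eq_zero_or_pos m with h | h
    · simp [h] at hm; omega
    · exact h
  rw [← Finset.card_range t]
  apply Finset.card_le_card_of_injOn (fun g => g / m)
  · intro g hg
    simp [ZN] at hg
    simp
    rw [Nat.div_lt_iff_lt_mul hmpos, ← hm]
    exact hg.1.1
  · intro g hg g' hg' hgg
    simp [ZN] at hg hg'
    have hd : (N : ℤ) ∣ a * ((g : ℤ) - g') := by
      have := dvd_sub hg.2 hg'.2
      ring_nf at this ⊢
      exact this
    obtain ⟨b, hb⟩ : (t : ℤ) ∣ a := Int.gcd_dvd_left a N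
    have hcop : IsCoprime (m : ℤ) b := by
      rw [Int.isCoprime_iff_gcd_eq_one]
      have h2 : Int.gcd a N = t * Int.gcd b m := by
        rw [hb, hm]; push_cast
        rw [Int.gcd_mul_left]; simp
      rw [← ht] at h2
      rw [Int.gcd_comm]
      exact Nat.eq_of_mul_eq_mul_left htpos (by omega)
    have hd2 : (m : ℤ) ∣ b * ((g : ℤ) - g') := by
      rw [hb, hm] at hd
      push_cast at hd
      rw [mul_assoc] at hd
      exact Int.dvd_of_mul_dvd_mul_left (by positivity) hd
    have hd3 : (m : ℤ) ∣ (g : ℤ) - g' := hcop.dvd_of_dvd_mul_left hd2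
    have hmod : g % m = g' % m := by
      have : g' ≡ g [MOD m] := (Nat.modEq_iff_dvd).2 hd3
      exact this.symm
    simp only at hgg
    rw [← Nat.div_add_mod g m, ← Nat.div_add_mod g' m, hmod, hgg]

lemma pw_mul_le (x : ℝ) (hx : 1 ≤ x) (t : ℕ) (ht : 0 < t) (b : ℤ) :
    (t : ℝ≥0∞) * pw x (t * b) ≤ pw x b := by
  unfold pw
  rw [← ENNReal.ofReal_natCast, ← ENNReal.ofReal_mul (by positivity)]
  apply ENNReal.ofReal_le_ofReal
  push_cast
  rw [abs_mul, Nat.abs_cast, Real.mul_rpow (by positivity) (by positivity), ← mul_assoc]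
  have h1 : (1 : ℝ) ≤ t := by exact_mod_cast ht
  have : (t : ℝ) * (t : ℝ) ^ (-x) ≤ 1 := by
    calc (t : ℝ) * (t : ℝ) ^ (-x) = (t : ℝ) ^ (1 + -x) := by
          rw [Real.rpow_add (by positivity), Real.rpow_one]
      _ ≤ 1 := Real.rpow_le_one_of_one_le_of_nonpos h1 (by linarith)
  exact mul_le_of_le_one_left (by positivity) this

lemma count_sum (N : ℕ) (hN : 0 < N) (x : ℝ) (hx : 1 ≤ x) (c : ℤ) :
    ∑ g ∈ ZN N, ∑' a : ℤ, (if a ≠ 0 ∧ (N : ℤ) ∣ c + a * (g : ℤ) then pw x a else 0) ≤ Z x := by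
  rw [← Summable.tsum_finsetSum (fun _ _ => ENNReal.summable)]
  set t := Int.gcd c N with ht
  have htpos : 0 < t := Int.gcd_pos_of_ne_zero_right _ (by positivity)
  have key : ∀ a : ℤ, ∑ g ∈ ZN N, (if a ≠ 0 ∧ (N : ℤ) ∣ c + a * (g : ℤ) then pw x a else 0)
      ≤ if a ≠ 0 ∧ (t : ℤ) ∣ a then (t : ℝ≥0∞) * pw x a else 0 := by
    intro a
    by_cases ha : a = 0
    · simp [ha]
    by_cases hex : ∃ g ∈ ZN N, (N : ℤ) ∣ c + a * (g : ℤ)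
    · obtain ⟨g, hg, hdv⟩ := hex
      have hgcop : IsCoprime (g : ℤ) (N : ℤ) := by
        simp [ZN] at hg
        exact Nat.isCoprime_iff_coprime.2 hg.2
      have hgcd : Int.gcd a N = t := by
        apply Nat.dvd_antisymm
        · apply Int.dvd_gcd
          · have h1 : ((Int.gcd a N : ℕ) : ℤ) ∣ c + a * g := (Int.gcd_dvd_right a N).trans hdv
            exact (Int.dvd_add_left ((Int.gcd_dvd_left a N).mul_right _)).1 h1
          · exact Int.gcd_dvd_right a N
        · apply Int.dvd_gcd
          · have h1 : (t : ℤ) ∣ c + a * g := (Int.gcd_dvd_right c N).trans hdv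
            have h2 : (t : ℤ) ∣ a * g := (Int.dvd_add_right (Int.gcd_dvd_left c N)).1 h1
            have h3 : IsCoprime (t : ℤ) (g : ℤ) :=
              (hgcop.of_isCoprime_of_dvd_right (Int.gcd_dvd_right c N)).symm
            exact h3.dvd_of_dvd_mul_right h2
          · exact Int.gcd_dvd_right c N
      have hta : (t : ℤ) ∣ a := hgcd ▸ Int.gcd_dvd_left a N
      simp only [ne_eq, ha, not_false_eq_true, true_and, hta, and_self, if_true]
      rw [← Finset.sum_filter, Finset.sum_const, nsmul_eq_mul]
      gcongr
      rw [← hgcd]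
      exact count_le N hN c a
    · push Not at hex
      rw [Finset.sum_eq_zero]
      · exact zero_le
      · intro g hg
        simp [hex g hg]
  refine (ENNReal.tsum_le_tsum key).trans ?_
  have hinj : Function.Injective (fun b : ℤ => (t : ℤ) * b) := by
    intro b b' h
    exact mul_left_cancel₀ (by positivity : (t : ℤ) ≠ 0) h
  rw [← hinj.tsum_eq]
  · unfold Z
    apply ENNReal.tsum_le_tsum
    intro b
    by_cases hb : b = 0
    · simp [hb]
    · simp only [ne_eq, mul_eq_zero, hb, or_false, dvd_mul_right, and_true]
      rw [if_pos (by simp; omega)]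
      simpa using pw_mul_le x hx t htpos b
  · intro a ha
    simp at ha
    obtain ⟨b, hb⟩ := ha.2.1
    exact ⟨b, hb.symm⟩

lemma sum_thE_le {d : ℕ} (N : ℕ) (hN : 0 < N) (x : ℝ) (hx : 1 ≤ x) (c : ℕ → ℝ≥0∞)
    (gs : Fin d → ℕ) :
    ∑ g ∈ ZN N, thE N x c gs g ≤ c d * Z x * ∏ j ∈ Finset.range d, (1 + c j * Z x) := by
  unfold thE
  rw [← Summable.tsum_finsetSum (fun _ _ => ENNReal.summable), ← tsum_R, ← ENNReal.tsum_mul_left]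
  apply ENNReal.tsum_le_tsum
  intro h
  calc _ = ∑ g ∈ ZN N, R x c h * c d * ∑' a : ℤ,
        (if a ≠ 0 ∧ (N : ℤ) ∣ (∑ j, h j * (gs j : ℤ)) + a * (g : ℤ) then pw x a else 0) := by
        apply Finset.sum_congr rfl
        intro g _
        rw [← ENNReal.tsum_mul_left]
        apply tsum_congr
        intro a
        split_ifs <;> simp [mul_assoc]
    _ ≤ R x c h * c d * Z x := by
        rw [← Finset.mul_sum]
        gcongr
        exact count_sum N hN x hx _
    _ = _ := by ring

lemma Z_eq (x : ℝ) (hx : 1 < x) : Z x = ENNReal.ofReal (2 * zetaR x) := by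
  have hsum : Summable (fun n : ℕ => ((n : ℝ) + 1) ^ (-x)) := by
    have := (summable_nat_add_iff 1).2 (Real.summable_nat_rpow.2 (by linarith : -x < -1))
    simpa using this
  have hz : ENNReal.ofReal (zetaR x) = ∑' n : ℕ, ENNReal.ofReal (((n : ℝ) + 1) ^ (-x)) :=
    ENNReal.ofReal_tsum_of_nonneg (fun n => by positivity) hsum
  unfold Z
  rw [tsum_of_add_one_of_neg_add_one ENNReal.summable ENNReal.summable,
    ENNReal.ofReal_mul (by norm_num), hz]
  have h1 : ∀ n : ℕ, ((n : ℤ) + 1) ≠ 0 := fun n => by omega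
  have h2 : ∀ n : ℕ, -((n : ℤ) + 1) ≠ 0 := fun n => by omega
  have h3 : ∀ n : ℕ, |(n : ℝ) + 1| = (n : ℝ) + 1 := fun n => abs_of_nonneg (by positivity)
  have e1 : (∑' n : ℕ, if ((n : ℤ) + 1) ≠ 0 then pw x ((n : ℤ) + 1) else 0)
      = ∑' n : ℕ, ENNReal.ofReal (((n : ℝ) + 1) ^ (-x)) := by
    apply tsum_congr
    intro n
    rw [if_pos (h1 n), pw]
    push_cast
    rw [h3]
  have e2 : (∑' n : ℕ, if -((n : ℤ) + 1) ≠ 0 then pw x (-((n : ℤ) + 1)) else 0)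
      = ∑' n : ℕ, ENNReal.ofReal (((n : ℝ) + 1) ^ (-x)) := by
    apply tsum_congr
    intro n
    rw [if_pos (h2 n), pw]
    push_cast
    rw [abs_neg, h3]
  rw [e1, e2]
  simp [two_mul]

lemma card_ZN (N : ℕ) : (ZN N).card = N.totient := by
  unfold ZN
  rw [Nat.totient_eq_card_coprime]
  congr 1
  ext k
  simp [Nat.coprime_comm]

lemma errE_ne_top {d : ℕ} (N : ℕ) (x : ℝ) (hx : 1 < x) (c : ℕ → ℝ≥0∞) (hc : ∀ j, c j ≠ ⊤)
    (g : Fin d → ℕ) : errE N x c g ≠ ⊤ := by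
  have h : errE N x c g ≤ ∏ j ∈ Finset.range d, (1 + c j * Z x) := by
    rw [← tsum_R]
    apply ENNReal.tsum_le_tsum
    intro h
    split_ifs <;> simp
  refine ne_top_of_le_ne_top ?_ h
  apply ENNReal.prod_ne_top
  intro j _
  rw [Z_eq x hx]
  exact ENNReal.add_ne_top.2 ⟨by simp, ENNReal.mul_ne_top (hc j) ENNReal.ofReal_ne_top⟩

lemma step {d : ℕ} (N : ℕ) (hN : 0 < N) (x l : ℝ) (hx : 1 < x) (h0 : 0 < l) (h1 : l ≤ 1)
    (hxl : 1 ≤ x * l) (c : ℕ → ℝ≥0∞) (hc : ∀ j, c j ≠ ⊤) (gs : Fin d → ℕ) (g0 : ℕ)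
    (E : Finset ℕ) (δ : ℝ) (hδ1 : δ < 1) (hE : (E.card : ℝ) ≤ δ * (N.totient : ℝ))
    (hmin : ∀ g ∈ ZN N \ E, errE N x c (Fin.snoc gs g0 : Fin (d + 1) → ℕ)
      ≤ errE N x c (Fin.snoc gs g : Fin (d + 1) → ℕ)) :
    (N.totient : ℝ≥0∞) * thE N x c gs g0 ^ l ≤ ENNReal.ofReal (1 / (1 - δ)) *
      (c d ^ l * Z (x * l) * ∏ j ∈ Finset.range d, (1 + c j ^ l * Z (x * l))) := by
  have hcard : (1 - δ) * (N.totient : ℝ) ≤ ((ZN N \ E).card : ℝ) := by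
    have h2 := Finset.le_card_sdiff E (ZN N)
    rw [card_ZN] at h2
    have h3 : (N.totient : ℝ) ≤ ((ZN N \ E).card : ℝ) + E.card := by
      have : N.totient ≤ (ZN N \ E).card + E.card := by omega
      exact_mod_cast this
    linarith
  have hcard2 : (N.totient : ℝ≥0∞) ≤ ENNReal.ofReal (1 / (1 - δ)) * ((ZN N \ E).card : ℝ≥0∞) := by
    have hd : 0 < 1 - δ := by linarith
    rw [← ENNReal.ofReal_natCast, ← ENNReal.ofReal_natCast, ← ENNReal.ofReal_mul (by positivity)]
    apply ENNReal.ofReal_le_ofReal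
    rw [one_div, ← div_eq_inv_mul, le_div_iff₀ hd]
    linarith
  calc (N.totient : ℝ≥0∞) * thE N x c gs g0 ^ l
      ≤ ENNReal.ofReal (1 / (1 - δ)) * ((ZN N \ E).card : ℝ≥0∞) * thE N x c gs g0 ^ l := by
        gcongr
    _ = ENNReal.ofReal (1 / (1 - δ)) * ∑ g ∈ ZN N \ E, thE N x c gs g0 ^ l := by
        rw [Finset.sum_const, nsmul_eq_mul, mul_assoc]
    _ ≤ ENNReal.ofReal (1 / (1 - δ)) * ∑ g ∈ ZN N \ E,
          thE N (x * l) (fun j => c j ^ l) gs g := by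
        gcongr with g hg
        refine le_trans ?_ (thE_rpow_le N x l h0 h1 c gs g)
        gcongr
        have := hmin g hg
        rw [errE_snoc, errE_snoc] at this
        exact (ENNReal.add_le_add_iff_left (errE_ne_top N x hx c hc gs)).1 this
    _ ≤ ENNReal.ofReal (1 / (1 - δ)) * ∑ g ∈ ZN N, thE N (x * l) (fun j => c j ^ l) gs g := by
        gcongr
        exact Finset.sdiff_subset
    _ ≤ _ := by
        gcongr
        exact sum_thE_le N hN (x * l) hxl _ gs

lemma final_step (φ e th D z c P P' : ℝ≥0∞) (l : ℝ) (h0 : 0 < l) (h1 : l ≤ 1)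
    (ih : φ * e ^ l + 1 ≤ P) (hs : φ * th ^ l ≤ D * (c * z * P')) (hP : P' ≤ P) :
    φ * (e + th) ^ l + 1 ≤ P * (1 + c * (z * D)) := by
  calc φ * (e + th) ^ l + 1 ≤ φ * (e ^ l + th ^ l) + 1 := by
        gcongr
        exact ENNReal.rpow_add_le_add_rpow _ _ h0.le h1
    _ = (φ * e ^ l + 1) + φ * th ^ l := by ring
    _ ≤ P + D * (c * z * P) := by
        have h3 : D * (c * z * P') ≤ D * (c * z * P) := by gcongr
        exact add_le_add ih (hs.trans h3)
    _ = _ := by ring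

end CBC

theorem cbc_uniformly_bounded_exclusions (α : ℝ) (hα : 1 < α) (γ : ℕ → ℝ) (hγ : ∀ j, 0 ≤ γ j)
    (N s : ℕ → ℕ) (hN : ∀ k, 2 ≤ N k) (hs : ∀ k, 1 ≤ s k)
    (gs : (k : ℕ) → Fin (s k) → ℕ) (E : ℕ → ℕ → Finset ℕ)
    (hE1 : ∀ k, E k 1 = ∅)
    (hE : ∀ k j, 2 ≤ j → j ≤ s k → E k j ⊂ ZN (N k))
    (hg1 : ∀ k, gs k ⟨0, hs k⟩ = 1)
    (hgmem : ∀ k, ∀ d : ℕ, ∀ hd : d + 1 ≤ s k, gs k ⟨d, hd⟩ ∈ ZN (N k) \ E k (d + 1))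
    (hmin : ∀ k, ∀ d : ℕ, ∀ hd : d + 1 ≤ s k, ∀ g ∈ ZN (N k) \ E k (d + 1),
      err2 (N k) α γ (fun j : Fin (d + 1) => gs k (Fin.castLE hd j))
        ≤ err2 (N k) α γ
            (Fin.snoc (fun j : Fin d => gs k (Fin.castLE (Nat.le_of_succ_le hd) j)) g))
    (δ : ℝ) (hδ0 : 0 < δ) (hδ1 : δ < 1)
    (hEδ : ∀ k d, 2 ≤ d → d ≤ s k → ((E k d).card : ℝ) ≤ δ * ((N k).totient : ℝ)) :
    ∀ k : ℕ, ∀ lam : ℝ, 1 / α < lam → lam ≤ 1 →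
      err2 (N k) α γ (gs k)
        ≤ ((1 / ((N k).totient : ℝ)) * ∑ u ∈ (Finset.range (s k)).powerset,
            (∏ j ∈ u, γ (j + 1) ^ lam) * (2 * zetaR (α * lam) / (1 - δ)) ^ u.card)
          ^ (1 / lam) := by
  intro k l hl0 hl1
  have hα0 : 0 < α := by linarith
  have hl : 0 < l := lt_trans (by positivity) hl0
  have hαl : 1 < α * l := by
    rw [div_lt_iff₀ hα0] at hl0
    linarith
  have hd : 0 < 1 - δ := by linarith
  have hNk : 0 < N k := by have := hN k; omega
  set c : ℕ → ENNReal := fun j => ENNReal.ofReal (γ (j + 1)) with hc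
  have hct : ∀ j, c j ≠ ⊤ := fun j => ENNReal.ofReal_ne_top
  set D : ENNReal := ENNReal.ofReal (1 / (1 - δ)) with hD
  have hD1 : 1 ≤ D := by
    rw [hD, ENNReal.one_le_ofReal, le_div_iff₀ hd]
    linarith
  have main : ∀ d : ℕ, ∀ hd : d ≤ s k,
      ((N k).totient : ENNReal) *
        CBC.errE (N k) α c (fun j : Fin d => gs k (Fin.castLE hd j)) ^ l + 1
        ≤ ∏ j ∈ Finset.range d, (1 + c j ^ l * (CBC.Z (α * l) * D)) := by
    intro d
    induction d with
    | zero =>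
      intro hd
      have : CBC.errE (N k) α c (fun j : Fin 0 => gs k (Fin.castLE hd j)) = 0 := by
        unfold CBC.errE
        rw [ENNReal.tsum_eq_zero]
        intro h
        rw [if_neg]
        intro H
        exact H.1 (Subsingleton.elim _ _)
      rw [this]
      simp [hl]
    | succ d ih =>
      intro hd1
      have heq : (fun j : Fin (d + 1) => gs k (Fin.castLE hd1 j))
          = Fin.snoc (fun j : Fin d => gs k (Fin.castLE (Nat.le_of_succ_le hd1) j))
              (gs k ⟨d, hd1⟩) := by
        funext j
        refine Fin.lastCases ?_ (fun i => ?_) j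
        · simp; rfl
        · simp
      have hEc : ((E k (d + 1)).card : ℝ) ≤ δ * ((N k).totient : ℝ) := by
        rcases Nat.eq_zero_or_pos d with h | h
        · subst h
          rw [hE1 k]
          simp
          positivity
        · exact hEδ k (d + 1) (by omega) hd1
      have hst := CBC.step (N k) hNk α l hα hl hl1 hαl.le c hct
        (fun j : Fin d => gs k (Fin.castLE (Nat.le_of_succ_le hd1) j)) (gs k ⟨d, hd1⟩)
        (E k (d + 1)) δ hδ1 hEc (by
          intro g hg
          have h := hmin k d hd1 g hg
          rw [CBC.err2_eq _ _ _ hγ, CBC.err2_eq _ _ _ hγ, heq,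
            ENNReal.toReal_le_toReal (CBC.errE_ne_top _ _ hα _ hct _)
              (CBC.errE_ne_top _ _ hα _ hct _)] at h
          exact h)
      rw [heq, CBC.errE_snoc, Finset.prod_range_succ]
      refine CBC.final_step _ _ _ D _ _ _ _ l hl hl1 (ih (Nat.le_of_succ_le hd1)) hst ?_
      gcongr with j hj
      exact le_mul_of_one_le_right (by simp) hD1
  have hm := main (s k) le_rfl
  have hphi : 0 < (N k).totient := Nat.totient_pos.2 hNk
  have hz0 : 0 ≤ zetaR (α * l) := tsum_nonneg fun n => by positivity
  set Q : ℝ := 2 * zetaR (α * l) / (1 - δ) with hQ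
  have hQ0 : 0 ≤ Q := by positivity
  have hZD : CBC.Z (α * l) * D = ENNReal.ofReal Q := by
    rw [CBC.Z_eq _ hαl, hD, ← ENNReal.ofReal_mul (by positivity), hQ]
    congr 1
    ring
  have hprod : ∏ j ∈ Finset.range (s k), (1 + c j ^ l * (CBC.Z (α * l) * D))
      = ENNReal.ofReal (∏ j ∈ Finset.range (s k), (1 + γ (j + 1) ^ l * Q)) := by
    have hnn : ∀ j, 0 ≤ γ (j + 1) ^ l := fun j => Real.rpow_nonneg (hγ _) _
    rw [ENNReal.ofReal_prod_of_nonneg (fun j _ => by have := hnn j; positivity)]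
    apply Finset.prod_congr rfl
    intro j _
    rw [hZD, hc, ENNReal.ofReal_add zero_le_one (mul_nonneg (hnn j) hQ0), ENNReal.ofReal_one,
      ENNReal.ofReal_mul (hnn j), ENNReal.ofReal_rpow_of_nonneg (hγ _) hl.le]
  have hsum : ∑ u ∈ (Finset.range (s k)).powerset, (∏ j ∈ u, γ (j + 1) ^ l) * Q ^ u.card
      = ∏ j ∈ Finset.range (s k), (1 + γ (j + 1) ^ l * Q) := by
    rw [Finset.prod_one_add]
    apply Finset.sum_congr rfl
    intro u _
    rw [Finset.prod_mul_distrib, Finset.prod_const]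
  rw [hsum]
  have hP0 : 0 ≤ ∏ j ∈ Finset.range (s k), (1 + γ (j + 1) ^ l * Q) :=
    Finset.prod_nonneg fun j _ => by have := Real.rpow_nonneg (hγ (j + 1)) l; positivity
  rw [CBC.err2_eq _ _ _ hγ, one_div l, Real.le_rpow_inv_iff_of_pos ENNReal.toReal_nonneg
    (by positivity) hl, one_div, ← div_eq_inv_mul, le_div_iff₀ (by exact_mod_cast hphi), mul_comm]
  rw [hprod] at hm
  have hm2 := ENNReal.toReal_mono ENNReal.ofReal_ne_top (le_self_add.trans hm)
  rw [ENNReal.toReal_ofReal hP0, ENNReal.toReal_mul, ← ENNReal.toReal_rpow,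
    ENNReal.toReal_natCast] at hm2
  exact hm2
end

section
/- Let $N \ge 2$, $\alpha > 1$, nonnegative weights $\tilde\gamma_j$ with $\gamma_u = \prod_{j\in u}\tilde\gamma_j$, and let $g^* = (g_1^*,\ldots,g_d^*) \in \mathcal{Z}_N^d$. Then for every $g \in \mathcal{Z}_N$, $$\theta_{N,d+1,\alpha,\gamma}(g) = 2\,\tilde\gamma_{d+1}\,\zeta(\alpha)\,N^{-\alpha}\,\big(1 + e^2(g_1^*,\ldots,g_d^*)\big) + \tilde\gamma_{d+1}\,\kappa_{N,d+1,\alpha,\gamma}(g),$$ where $\theta_{N,d+1,\alpha,\gamma}(g) = \sum_{h \in \mathbb{Z}^{d+1},\ h_{d+1}\ne 0,\ h\cdot(g^*,g) \equiv 0\ (\mathrm{mod}\ N)} r_\alpha(\gamma,h)$ and $\kappa_{N,d+1,\alpha,\gamma}(g) = \sum_{h_{d+1}\in\mathbb{Z},\ N \nmid h_{d+1}}\ \sum_{h\in\mathbb{Z}^d,\ h\cdot g^* \equiv -h_{d+1} g\ (\mathrm{mod}\ N)} |h_{d+1}|^{-\alpha}\, r_\alpha(\gamma,h)$. -/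
open Finset
open scoped Classical

lemma rpw_eq {d : ℕ} (α : ℝ) (γ : ℕ → ℝ) (h : Fin d → ℤ) :
    rpw α γ h = ∏ j : Fin d, if h j ≠ 0 then γ ((j : ℕ) + 1) * |(h j : ℝ)| ^ (-α) else 1 := by
  unfold rpw
  rw [Finset.prod_filter]

lemma rpw_snoc {d : ℕ} (α : ℝ) (γ : ℕ → ℝ) (h : Fin d → ℤ) (z : ℤ) :
    rpw α γ (Fin.snoc h z : Fin (d + 1) → ℤ)
      = rpw α γ h * (if z ≠ 0 then γ (d + 1) * |(z : ℝ)| ^ (-α) else 1) := by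
  rw [rpw_eq, rpw_eq, Fin.prod_univ_castSucc]
  simp

lemma rpw_nonneg {d : ℕ} (α : ℝ) (γ : ℕ → ℝ) (hγ : ∀ j, 0 ≤ γ j) (h : Fin d → ℤ) :
    0 ≤ rpw α γ h := by
  unfold rpw
  exact Finset.prod_nonneg fun j _ => mul_nonneg (hγ _) (Real.rpow_nonneg (abs_nonneg _) _)

lemma summable_w (α : ℝ) (hα : 1 < α) : Summable fun z : ℤ => |(z : ℝ)| ^ (-α) :=
  Real.summable_abs_int_rpow hα

lemma summable_rpw (α : ℝ) (hα : 1 < α) (γ : ℕ → ℝ) (hγ : ∀ j, 0 ≤ γ j) (d : ℕ) :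
    Summable fun h : Fin d → ℤ => rpw α γ h := by
  induction d with
  | zero => exact Summable.of_finite
  | succ d ih =>
    rw [← (Fin.snocEquiv (fun _ : Fin (d + 1) => ℤ)).summable_iff]
    have h1 : Summable fun z : ℤ => if z ≠ 0 then γ (d + 1) * |(z : ℝ)| ^ (-α) else 1 := by
      have : Summable fun z : ℤ => γ (d + 1) * |(z : ℝ)| ^ (-α) + if z = 0 then 1 else 0 :=
        ((summable_w α hα).mul_left _).add (summable_of_hasFiniteSupport
          ((Set.finite_singleton (0 : ℤ)).subset (by intro z; simp)))
      refine this.congr fun z => ?_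
      by_cases hz : z = 0
      · subst hz
        have : -α ≠ 0 := by linarith
        simp [Real.zero_rpow this]
      · simp [hz]
    have := h1.mul_of_nonneg ih (fun z => by
      dsimp only
      split_ifs
      · exact mul_nonneg (hγ _) (Real.rpow_nonneg (abs_nonneg _) _)
      · simp) (fun h => rpw_nonneg α γ hγ h)
    refine this.congr fun p => ?_
    have := rpw_snoc α γ p.2 p.1
    simp only [Function.comp, Fin.snocEquiv, Equiv.coe_fn_mk]
    rw [mul_comm]
    exact this.symm

lemma tsum_w (α : ℝ) (hα : 1 < α) : ∑' z : ℤ, |(z : ℝ)| ^ (-α) = 2 * zetaR α := by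
  have hs := summable_w α hα
  have h0 : (-α) ≠ 0 := by linarith
  have hp : Summable fun n : ℕ => |(((n : ℤ) + 1 : ℤ) : ℝ)| ^ (-α) :=
    hs.comp_injective (i := fun n : ℕ => (n : ℤ) + 1) (fun a b h => by simpa using h)
  have hm : Summable fun n : ℕ => |((-((n : ℤ) + 1) : ℤ) : ℝ)| ^ (-α) :=
    hs.comp_injective (i := fun n : ℕ => -((n : ℤ) + 1)) (fun a b h => by simpa using h)
  rw [tsum_of_add_one_of_neg_add_one (f := fun z : ℤ => |(z : ℝ)| ^ (-α)) hp hm]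
  have e : ∀ n : ℕ, |(n : ℝ) + 1| = n + 1 := fun n => abs_of_nonneg (by positivity)
  have e' : ∀ n : ℕ, |-1 + -(n : ℝ)| = n + 1 := fun n => by
    rw [← e n, ← abs_neg]; congr 1; ring
  simp [Real.zero_rpow h0, e, e', zetaR]
  ring

lemma tsum_A (N : ℕ) (hN : 2 ≤ N) (α : ℝ) (hα : 1 < α) :
    ∑' z : ℤ, (if (N : ℤ) ∣ z then |(z : ℝ)| ^ (-α) else 0) = (N : ℝ) ^ (-α) * (2 * zetaR α) := by
  have hinj : Function.Injective fun z : ℤ => (N : ℤ) * z := fun a b h => by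
    have : (N : ℤ) ≠ 0 := by omega
    simpa [this, show N ≠ 0 by omega] using h
  rw [← hinj.tsum_eq (f := fun z : ℤ => if (N : ℤ) ∣ z then |(z : ℝ)| ^ (-α) else 0), ← tsum_w α hα,
    ← tsum_mul_left]
  · refine tsum_congr fun z => ?_
    simp [abs_mul, Real.mul_rpow]
  · intro z hz
    have : (N : ℤ) ∣ z := by
      by_contra h
      simp [h] at hz
    obtain ⟨c, rfl⟩ := this
    exact ⟨c, rfl⟩

lemma summable_if {β : Type*} {f : β → ℝ} (hf : Summable f) (h0 : ∀ b, 0 ≤ f b) (P : β → Prop)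
    [DecidablePred P] :
    Summable fun b => if P b then f b else 0 :=
  Summable.of_nonneg_of_le (fun b => by split_ifs <;> simp [h0]) 
    (fun b => by split_ifs <;> simp [h0]) hf

lemma tsum_B (N : ℕ) (α : ℝ) (hα : 1 < α)
    (γ : ℕ → ℝ) (hγ : ∀ j, 0 ≤ γ j) (d : ℕ) (gs : Fin d → ℕ) :
    ∑' h : Fin d → ℤ, (if (N : ℤ) ∣ ∑ j, h j * (gs j : ℤ) then rpw α γ h else 0)
      = 1 + err2 N α γ gs := by
  rw [(summable_if (summable_rpw α hα γ hγ d) (rpw_nonneg α γ hγ)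
    (fun h => (N : ℤ) ∣ ∑ j, h j * (gs j : ℤ))).tsum_eq_add_tsum_ite 0]
  congr 1
  · simp [rpw]
  · unfold err2
    refine tsum_congr fun h => ?_
    by_cases hh : h = 0 <;> simp [hh]

theorem theta_decomposition (N : ℕ) (hN : 2 ≤ N) (α : ℝ) (hα : 1 < α)
    (γ : ℕ → ℝ) (hγ : ∀ j, 0 ≤ γ j) (d : ℕ) (gs : Fin d → ℕ)
    (hgs : ∀ j, gs j ∈ ZN N) (g : ℕ) (hg : g ∈ ZN N) :
    theta N α γ gs g
      = 2 * γ (d + 1) * zetaR α * (N : ℝ) ^ (-α) * (1 + err2 N α γ gs)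
        + γ (d + 1) * kappa N α γ gs g := by
  have hw0 : ∀ z : ℤ, 0 ≤ |(z : ℝ)| ^ (-α) := fun z => Real.rpow_nonneg (abs_nonneg _) _
  have h0 : (-α) ≠ 0 := by linarith
  have hS : Summable fun p : ℤ × (Fin d → ℤ) => |(p.1 : ℝ)| ^ (-α) * rpw α γ p.2 :=
    (summable_w α hα).mul_of_nonneg (summable_rpw α hα γ hγ d) hw0 (rpw_nonneg α γ hγ)
  have hS0 : ∀ p : ℤ × (Fin d → ℤ), 0 ≤ |(p.1 : ℝ)| ^ (-α) * rpw α γ p.2 :=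
    fun p => mul_nonneg (hw0 _) (rpw_nonneg α γ hγ _)
  have hA := summable_if (summable_w α hα) hw0 (fun z => (N : ℤ) ∣ z)
  have hB := summable_if (summable_rpw α hα γ hγ d) (rpw_nonneg α γ hγ)
    (fun h => (N : ℤ) ∣ ∑ j, h j * (gs j : ℤ))
  have hA0 : ∀ z : ℤ, 0 ≤ (if (N : ℤ) ∣ z then |(z : ℝ)| ^ (-α) else 0) := fun z => by
    split_ifs
    · exact hw0 z
    · exact le_rfl
  have hB0 : ∀ h : Fin d → ℤ,
      0 ≤ (if (N : ℤ) ∣ ∑ j, h j * (gs j : ℤ) then rpw α γ h else 0) := fun h => by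
    split_ifs
    · exact rpw_nonneg α γ hγ h
    · exact le_rfl
  have hAB := hA.mul_of_nonneg hB hA0 hB0
  have hprod := hA.tsum_mul_tsum hB hAB
  rw [tsum_A N hN α hα, tsum_B N α hα γ hγ d gs] at hprod
  have hK := summable_if hS hS0 (fun p => ¬ ((N : ℤ) ∣ p.1) ∧
    ((N : ℤ) ∣ (∑ j, p.2 j * (gs j : ℤ) + p.1 * (g : ℤ))))
  have key : theta N α γ gs g = γ (d + 1) * ((N : ℝ) ^ (-α) * (2 * zetaR α) * (1 + err2 N α γ gs)
      + kappa N α γ gs g) := by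
    rw [hprod]
    unfold kappa
    rw [← hAB.tsum_add hK, ← tsum_mul_left]
    unfold theta
    rw [← (Fin.snocEquiv (fun _ : Fin (d + 1) => ℤ)).tsum_eq]
    refine tsum_congr fun p => ?_
    obtain ⟨z, h⟩ := p
    have e : (Fin.snocEquiv (fun _ : Fin (d + 1) => ℤ)) (z, h) = (Fin.snoc h z : Fin (d + 1) → ℤ) := rfl
    rw [e, rpw_snoc, Fin.sum_univ_castSucc]
    simp only [Fin.snoc_last, Fin.snoc_castSucc]
    by_cases hz : z = 0
    · subst hz
      simp [Real.zero_rpow h0]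
    · by_cases hd : (N : ℤ) ∣ z
      · have := dvd_add_left (b := ∑ j, h j * (gs j : ℤ)) (hd.mul_right (g : ℤ))
        by_cases h2 : (N : ℤ) ∣ ∑ j, h j * (gs j : ℤ)
        · simp [hz, hd, this, h2]; ring
        · simp [hz, hd, this, h2]
      · by_cases h2 : (N : ℤ) ∣ ∑ j, h j * (gs j : ℤ) + z * (g : ℤ)
        · simp [hz, hd, h2]; ring
        · simp [hz, hd, h2]
  rw [key]; ring
end

section
/- Let $N \ge 2$, $\alpha > 1$, nonnegative weights $\tilde\gamma_j$ with $\gamma_u = \prod_{j\in u}\tilde\gamma_j$, let $g^* = (g_1^*,\ldots,g_d^*) \in \mathcal{Z}_N^d$, and let $1/\alpha < \lambda \le 1$. Then for every $g \in \mathcal{Z}_N$, $$\big(e^2(g_1^*,\ldots,g_d^*,g)\big)^{\lambda} \le \big(1 + 2^{\lambda}\tilde\gamma_{d+1}^{\lambda}\zeta(\alpha\lambda)N^{-\alpha\lambda}\big)\big(e^2(g_1^*,\ldots,g_d^*)\big)^{\lambda} + 2^{\lambda}\tilde\gamma_{d+1}^{\lambda}\zeta(\alpha\lambda)N^{-\alpha\lambda}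 + \tilde\gamma_{d+1}^{\lambda}\big(\kappa_{N,d+1,\alpha,\gamma}(g)\big)^{\lambda}.$$ -/
open Finset
open scoped Classical

lemma aux_radd {p : ℝ} (hp : 0 ≤ p) (hp1 : p ≤ 1) {a b : ℝ} (ha : 0 ≤ a) (hb : 0 ≤ b) :
    (a + b) ^ p ≤ a ^ p + b ^ p := by
  lift a to NNReal using ha
  lift b to NNReal using hb
  exact_mod_cast NNReal.rpow_add_le_add_rpow a b hp hp1

lemma aux_rsum {ι : Type*} {p : ℝ} (hp : 0 < p) (hp1 : p ≤ 1) (s : Finset ι) (f : ι → ℝ)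
    (hf : ∀ i, 0 ≤ f i) : (∑ i ∈ s, f i) ^ p ≤ ∑ i ∈ s, f i ^ p := by
  induction s using Finset.induction_on with
  | empty => simp [Real.zero_rpow hp.ne']
  | insert a s ha ih =>
    rw [Finset.sum_insert ha, Finset.sum_insert ha]
    exact (aux_radd hp.le hp1 (hf a) (Finset.sum_nonneg fun i _ => hf i)).trans (by gcongr)

lemma aux_rtsum {ι : Type*} {p : ℝ} (hp : 0 < p) (hp1 : p ≤ 1) (f : ι → ℝ)
    (hf : ∀ i, 0 ≤ f i) (hs : Summable fun i => f i ^ p) :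
    (∑' i, f i) ^ p ≤ ∑' i, f i ^ p := by
  have h0 : ∀ i, 0 ≤ f i ^ p := fun i => Real.rpow_nonneg (hf i) _
  have hT : 0 ≤ ∑' i, f i ^ p := tsum_nonneg h0
  have key : ∑' i, f i ≤ (∑' i, f i ^ p) ^ (1 / p) := by
    refine Real.tsum_le_of_sum_le hf fun s => ?_
    have hss : 0 ≤ ∑ i ∈ s, f i := Finset.sum_nonneg fun i _ => hf i
    have h2 := (aux_rsum hp hp1 s f hf).trans (hs.sum_le_tsum s fun i _ => h0 i)
    have h3 := Real.rpow_le_rpow (Real.rpow_nonneg hss p) h2 (z := 1 / p) (by positivity)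
    rwa [← Real.rpow_mul hss, mul_one_div_cancel hp.ne', Real.rpow_one] at h3
  have h4 := Real.rpow_le_rpow (tsum_nonneg hf) key hp.le
  rwa [← Real.rpow_mul hT, one_div_mul_cancel hp.ne', Real.rpow_one] at h4

lemma aux_zsum {x : ℝ} (hx : 1 < x) : Summable fun n : ℕ => ((n : ℝ) + 1) ^ (-x) := by
  have := (summable_nat_add_iff 1).mpr (Real.summable_nat_rpow.mpr (by linarith : -x < -1))
  simpa using this

lemma aux_zeta {x p : ℝ} (hp : 0 < p) (hp1 : p ≤ 1) (hxp : 1 < x * p) :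
    zetaR x ^ p ≤ zetaR (x * p) := by
  have e : ∀ n : ℕ, (((n : ℝ) + 1) ^ (-x)) ^ p = ((n : ℝ) + 1) ^ (-(x * p)) := fun n => by
    rw [← Real.rpow_mul (by positivity), neg_mul]
  have h := aux_rtsum hp hp1 (fun n : ℕ => ((n : ℝ) + 1) ^ (-x)) (fun n => by positivity)
    (by simpa only [e] using aux_zsum hxp)
  simpa only [e, zetaR] using h

lemma aux_int {x : ℝ} (hx : 1 < x) :
    HasSum (fun k : ℤ => if k ≠ 0 then |(k : ℝ)| ^ (-x) else 0) (2 * zetaR x) := by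
  have h := (aux_zsum hx).hasSum
  have h1 := HasSum.of_add_one_of_neg_add_one
    (f := fun k : ℤ => if k ≠ 0 then |(k : ℝ)| ^ (-x) else 0) (m := zetaR x) (m' := zetaR x)
    (by
      refine h.congr_fun ?_ |> id
      intro n
      have : (n : ℤ) + 1 ≠ 0 := by omega
      have h2 : (0 : ℝ) ≤ (n : ℝ) + 1 := by positivity
      simp [this, abs_of_nonneg h2])
    (by
      refine h.congr_fun ?_ |> id
      intro n
      have : -((n : ℤ) + 1) ≠ 0 := by omega
      have h2 : (0 : ℝ) ≤ (n : ℝ) + 1 := by positivity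
      rw [if_pos this]
      push_cast
      rw [abs_neg, abs_of_nonneg h2])
  convert h1 using 1
  simp; ring

lemma aux_intN {x : ℝ} (hx : 1 < x) (N : ℕ) (hN : 2 ≤ N) :
    HasSum (fun k : ℤ => if k ≠ 0 ∧ (N : ℤ) ∣ k then |(k : ℝ)| ^ (-x) else 0)
      (2 * zetaR x * (N : ℝ) ^ (-x)) := by
  have hN0 : (N : ℤ) ≠ 0 := by omega
  have hinj : Function.Injective fun m : ℤ => (N : ℤ) * m := mul_right_injective₀ hN0
  rw [← hinj.hasSum_iff]
  · refine ((aux_int hx).mul_right ((N : ℝ) ^ (-x))).congr_fun fun m => ?_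
    by_cases hm : m = 0
    · simp [hm]
    · have h1 : (N : ℤ) * m ≠ 0 := mul_ne_zero hN0 hm
      simp only [Function.comp_apply]
      rw [if_pos ⟨h1, dvd_mul_right _ _⟩, if_pos hm]
      push_cast
      rw [abs_mul, Real.mul_rpow (abs_nonneg _) (abs_nonneg _), mul_comm, Nat.abs_cast]
  · intro k hk
    rw [if_neg]
    rintro ⟨_, m, rfl⟩
    exact hk ⟨m, rfl⟩

lemma aux_rpw_nonneg {d : ℕ} {α : ℝ} {γ : ℕ → ℝ} (hγ : ∀ j, 0 ≤ γ j) (h : Fin d → ℤ) :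
    0 ≤ rpw α γ h :=
  Finset.prod_nonneg fun j _ => mul_nonneg (hγ _) (Real.rpow_nonneg (abs_nonneg _) _)

lemma aux_rpw_snoc {d : ℕ} (α : ℝ) (γ : ℕ → ℝ) (h : Fin d → ℤ) (k : ℤ) :
    rpw α γ (Fin.snoc h k : Fin (d + 1) → ℤ) =
      (if k ≠ 0 then γ (d + 1) * |(k : ℝ)| ^ (-α) else 1) * rpw α γ h := by
  unfold rpw
  rw [Finset.prod_filter, Finset.prod_filter, Fin.prod_univ_castSucc, mul_comm]
  simp

lemma aux_rpw_summable {α : ℝ} (hα : 1 < α) {γ : ℕ → ℝ} (hγ : ∀ j, 0 ≤ γ j) (d : ℕ) :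
    Summable fun h : Fin d → ℤ => rpw α γ h := by
  induction d with
  | zero => exact Summable.of_finite
  | succ d ih =>
    rw [← (Fin.snocEquiv fun _ : Fin (d + 1) => ℤ).summable_iff]
    have hw : Summable fun k : ℤ => (if k ≠ 0 then γ (d + 1) * |(k : ℝ)| ^ (-α) else 1) := by
      have h1 := ((aux_int hα).summable.mul_left (γ (d + 1))).add
        (hasSum_ite_eq (0 : ℤ) (1 : ℝ)).summable
      refine h1.congr fun k => ?_
      by_cases hk : k = 0 <;> simp [hk]
    have h2 := hw.mul_of_nonneg ih
      (fun k => by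
        show (0 : ℝ) ≤ if k ≠ 0 then γ (d + 1) * |(k : ℝ)| ^ (-α) else 1
        have := hγ (d + 1)
        split_ifs <;> positivity)
      (fun h => aux_rpw_nonneg hγ h)
    exact h2.congr fun p => (aux_rpw_snoc α γ p.2 p.1).symm

lemma aux_decomp (N : ℕ) (hN : 2 ≤ N) (α : ℝ) (hα : 1 < α)
    (γ : ℕ → ℝ) (hγ : ∀ j, 0 ≤ γ j) (d : ℕ) (gs : Fin d → ℕ) (g : ℕ) :
    err2 N α γ (Fin.snoc gs g : Fin (d + 1) → ℕ) = err2 N α γ gs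
      + (γ (d + 1) * (2 * zetaR α * (N : ℝ) ^ (-α))) * (err2 N α γ gs + 1)
      + γ (d + 1) * kappa N α γ gs g := by
  have hr := aux_rpw_summable hα hγ d
  have hr0 : ∀ h : Fin d → ℤ, 0 ≤ rpw α γ h := aux_rpw_nonneg hγ
  set T : (Fin d → ℤ) → ℝ := fun h =>
    if h ≠ 0 ∧ ((N : ℤ) ∣ ∑ j, h j * (gs j : ℤ)) then rpw α γ h else 0 with hT
  have hT0 : ∀ h, 0 ≤ T h := fun h => by
    have := hr0 h
    simp only [hT]; split_ifs <;> simp [this]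
  have hTs : Summable T := hr.of_nonneg_of_le hT0 fun h => by
    have := hr0 h
    simp only [hT]; split_ifs <;> simp [this]
  have hTh : HasSum T (err2 N α γ gs) := hTs.hasSum
  set a : ℤ → ℝ := fun k => if k = 0 then 1 else 0 with ha
  have hah : HasSum a 1 := hasSum_ite_eq 0 1
  have ha0 : ∀ k, 0 ≤ a k := fun k => by simp only [ha]; split_ifs <;> simp
  set b : ℤ → ℝ := fun k => γ (d + 1) *
    (if k ≠ 0 ∧ (N : ℤ) ∣ k then |(k : ℝ)| ^ (-α) else 0) with hb
  have hbh : HasSum b (γ (d + 1) * (2 * zetaR α * (N : ℝ) ^ (-α))) :=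
    (aux_intN hα N hN).mul_left _
  have hb0 : ∀ k, 0 ≤ b k := fun k => by
    have := hγ (d + 1)
    simp only [hb]; split_ifs <;> positivity
  set E : (Fin d → ℤ) → ℝ := fun h => T h + if h = 0 then 1 else 0 with hE
  have hEh : HasSum E (err2 N α γ gs + 1) := hTh.add (hasSum_ite_eq 0 1)
  have hE0 : ∀ h, 0 ≤ E h := fun h => by
    have := hT0 h
    simp only [hE]; split_ifs <;> linarith
  have hEe : ∀ h, E h = if ((N : ℤ) ∣ ∑ j, h j * (gs j : ℤ)) then rpw α γ h else 0 := fun h => by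
    by_cases h0 : h = 0
    · subst h0; simp [hE, hT, rpw]
    · simp [hE, hT, h0]
  have hA := hah.mul hTh (hah.summable.mul_of_nonneg hTh.summable ha0 hT0)
  have hB := hbh.mul hEh (hbh.summable.mul_of_nonneg hEh.summable hb0 hE0)
  have hC : HasSum (fun p : ℤ × (Fin d → ℤ) =>
      if ¬ ((N : ℤ) ∣ p.1) ∧ ((N : ℤ) ∣ (∑ j, p.2 j * (gs j : ℤ) + p.1 * (g : ℤ)))
      then |(p.1 : ℝ)| ^ (-α) * rpw α γ p.2 else 0) (kappa N α γ gs g) := by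
    refine Summable.hasSum ?_
    have hz := aux_int hα
    have hs := hz.summable.mul_of_nonneg hr
      (fun k => by
        show (0 : ℝ) ≤ if k ≠ 0 then |(k : ℝ)| ^ (-α) else 0
        split_ifs <;> positivity) hr0
    refine hs.of_nonneg_of_le (fun p => ?_) (fun p => ?_)
    · have := hr0 p.2
      split_ifs <;> positivity
    · have := hr0 p.2
      split_ifs with h1 h2 h2
      · exact le_rfl
      · exact absurd (by simp [not_not.mp h2]) h1.1
      · positivity
      · simp
  have hsum := (hA.add hB).add (hC.mul_left (γ (d + 1)))
  rw [one_mul] at hsum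
  rw [← hsum.tsum_eq]
  unfold err2
  rw [← (Fin.snocEquiv fun _ : Fin (d + 1) => ℤ).tsum_eq]
  refine tsum_congr fun p => ?_
  obtain ⟨k, h⟩ := p
  have e1 : (Fin.snocEquiv fun _ : Fin (d + 1) => ℤ) (k, h) = (Fin.snoc h k : Fin (d + 1) → ℤ) :=
    rfl
  have e2 : (∑ j, (Fin.snoc h k : Fin (d + 1) → ℤ) j *
      ((Fin.snoc gs g : Fin (d + 1) → ℕ) j : ℤ)) = ∑ j, h j * (gs j : ℤ) + k * (g : ℤ) := by
    rw [Fin.sum_univ_castSucc]; simp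
  have e3 : (Fin.snoc h k : Fin (d + 1) → ℤ) ≠ 0 ↔ (k ≠ 0 ∨ h ≠ 0) := by
    rw [← not_and_or, not_iff_not]
    constructor
    · intro hh
      refine ⟨by simpa using congrFun hh (Fin.last d), ?_⟩
      funext j
      simpa using congrFun hh j.castSucc
    · rintro ⟨rfl, rfl⟩
      funext j
      refine Fin.lastCases ?_ (fun i => ?_) j <;> simp
  rw [e1, e2, aux_rpw_snoc]
  simp only [e3]
  rw [hEe]
  by_cases hk : k = 0
  · subst hk
    simp [ha, hb, hT]
  · by_cases hNk : (N : ℤ) ∣ k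
    · have : (N : ℤ) ∣ ∑ j, h j * (gs j : ℤ) + k * (g : ℤ) ↔ (N : ℤ) ∣ ∑ j, h j * (gs j : ℤ) :=
        Int.dvd_add_left (hNk.mul_right _) |>.trans Iff.rfl
      simp [ha, hb, hk, hNk, this]
    · simp [ha, hb, hk, hNk, mul_assoc]

theorem error_recursion_jensen (N : ℕ) (hN : 2 ≤ N) (α : ℝ) (hα : 1 < α)
    (γ : ℕ → ℝ) (hγ : ∀ j, 0 ≤ γ j) (d : ℕ) (gs : Fin d → ℕ)
    (hgs : ∀ j, gs j ∈ ZN N) (lam : ℝ) (hlam1 : 1 / α < lam) (hlam2 : lam ≤ 1)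
    (g : ℕ) (hg : g ∈ ZN N) :
    err2 N α γ (Fin.snoc gs g) ^ lam
      ≤ (1 + 2 ^ lam * γ (d + 1) ^ lam * zetaR (α * lam) * (N : ℝ) ^ (-(α * lam)))
          * err2 N α γ gs ^ lam
        + 2 ^ lam * γ (d + 1) ^ lam * zetaR (α * lam) * (N : ℝ) ^ (-(α * lam))
        + γ (d + 1) ^ lam * kappa N α γ gs g ^ lam := by
  have hα0 : 0 < α := by linarith
  have hl0 : 0 < lam := lt_trans (by positivity) hlam1
  have hal : 1 < α * lam := by
    rw [div_lt_iff₀ hα0] at hlam1; linarith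
  have hr0 : ∀ {m : ℕ} (h : Fin m → ℤ), 0 ≤ rpw α γ h := fun h => aux_rpw_nonneg hγ h
  have he0 : 0 ≤ err2 N α γ gs := tsum_nonneg fun h => by
    have := hr0 h
    split_ifs <;> simp [this]
  have hk0 : 0 ≤ kappa N α γ gs g := tsum_nonneg fun p => by
    have := hr0 p.2
    split_ifs <;> positivity
  have hz0 : 0 ≤ zetaR α := tsum_nonneg fun n => by positivity
  have hg0 := hγ (d + 1)
  rw [aux_decomp N hN α hα γ hγ d gs g]
  set c := γ (d + 1) * (2 * zetaR α * (N : ℝ) ^ (-α)) with hc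
  set e := err2 N α γ gs with he
  have hc0 : 0 ≤ c := by positivity
  have hcl : c ^ lam ≤ 2 ^ lam * γ (d + 1) ^ lam * zetaR (α * lam) * (N : ℝ) ^ (-(α * lam)) := by
    rw [hc, Real.mul_rpow hg0 (by positivity), Real.mul_rpow (by positivity) (by positivity),
      Real.mul_rpow (by positivity) hz0, ← Real.rpow_mul (by positivity), neg_mul]
    have := aux_zeta hl0 hlam2 hal
    calc _ = 2 ^ lam * γ (d + 1) ^ lam * zetaR α ^ lam * (N : ℝ) ^ (-(α * lam)) := by ring
      _ ≤ _ := by gcongr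
  have h1 := aux_radd hl0.le hlam2 (a := e + c * (e + 1)) (b := γ (d + 1) * kappa N α γ gs g)
    (by positivity) (by positivity)
  have h2 := aux_radd hl0.le hlam2 (a := e) (b := c * (e + 1)) (by positivity) (by positivity)
  have h3 := aux_radd hl0.le hlam2 (a := e) (b := 1) (by positivity) (by positivity)
  rw [Real.mul_rpow hg0 hk0] at h1
  rw [Real.mul_rpow hc0 (by positivity)] at h2
  rw [Real.one_rpow] at h3
  have hel : 0 ≤ e ^ lam := Real.rpow_nonneg he0 _
  have h4 : c ^ lam * (e + 1) ^ lam ≤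
      2 ^ lam * γ (d + 1) ^ lam * zetaR (α * lam) * (N : ℝ) ^ (-(α * lam)) * (e ^ lam + 1) :=
    mul_le_mul hcl h3 (by positivity) ((Real.rpow_nonneg hc0 _).trans hcl)
  linarith
end
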